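/- Let r ∈ ℝ, T > 0, E > 0, a, b ∈ ℝ, and let β : ℝ → ℝ be continuously differentiable with β(0) = 0 and β′(0) finite. Suppose H : ℝ × (0,T) → ℝ is a sufficiently smooth solution of the Gamma equation ∂_τ H = ∂²_x β(H) + ∂_x β(H) + r ∂_x H on ℝ × (0,T) such that for each τ, H(x,τ) → 0 and ∂_x H(x,τ) → 0 as x → −∞, and such that x ↦ (S − E e^x)⁺ H(x,τ) and x ↦ e^x H(x,τ) are integrable on (−∞, ln(S/E)) for each S > 0 (with differentiation under the integral sign justified). Then the function V(S,t) = a S + b e^{-r(T−t)} + ∫_{−∞}^{∞} (S − E e^x)⁺ H(x, T−t) dx satisfies S ∂²_S V(S,t) = H(ln(S/E), T−t) and solves the nonlinear Black–Scholes equation ∂_t V + S β(S ∂²_S V) + r S ∂_S V − r V = 0 for all S > 0, t ∈ (0,T). -/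

import Mathlib

open MeasureTheory Real Filter

open Set Topology in
/-- A fundamental theorem of calculus for a continuous function which is differentiable away from
its zeros, with prescribed derivative vanishing at all but countably many of its zeros. -/
theorem integral_eq_sub_of_hasDerivAt_of_ne_zero {f f' : ℝ → ℝ} {a b : ℝ} {s : Set ℝ}
    (hab : a ≤ b) (hf : ContinuousOn f (Icc a b))
    (hderiv : ∀ x ∈ Ioo a b, f x ≠ 0 → HasDerivAt f (f' x) x)
    (hs : s.Countable) (hzero : ∀ x ∈ Ioo a b, x ∉ s → f x = 0 → f' x = 0)
    (hint : IntervalIntegrable f' volume a b) :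
    ∫ x in a..b, f' x = f b - f a := by
  set χ : ℕ → ℝ → ℝ := fun n u => max 0 (min 1 ((n + 1) * |u| - 1)) with hχ
  have hχc : ∀ n, Continuous (χ n) := fun n => by fun_prop
  have hχ1 : ∀ n u, ‖χ n u‖ ≤ 1 := by
    intro n u
    rw [Real.norm_eq_abs, abs_of_nonneg (le_max_left _ _)]
    exact max_le zero_le_one (min_le_left _ _)
  have hχ0 : ∀ n : ℕ, ∀ u : ℝ, |u| ≤ 1 / (n + 1 : ℝ) → χ n u = 0 := by
    intro n u hu
    rw [le_div_iff₀ (by positivity)] at hu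
    exact max_eq_left ((min_le_right _ _).trans (by linarith))
  have hχlim : ∀ u, u ≠ 0 → Tendsto (fun n => χ n u) atTop (𝓝 1) := by
    intro u hu
    apply tendsto_const_nhds.congr'
    have hu' : 0 < |u| := abs_pos.2 hu
    obtain ⟨N, hN⟩ := exists_nat_gt (2 / |u|)
    filter_upwards [eventually_ge_atTop N] with n hn
    have h1 : (2 : ℝ) ≤ (n + 1) * |u| := by
      rw [div_lt_iff₀ hu'] at hN
      have : (N : ℝ) ≤ n := by exact_mod_cast hn
      nlinarith
    have h2 : min 1 (((n : ℝ) + 1) * |u| - 1) = 1 := min_eq_left (by linarith)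
    simp only [hχ, h2]
    norm_num
  set θ : ℕ → ℝ → ℝ := fun n u => ∫ v in (0 : ℝ)..u, χ n v with hθ
  have hθd : ∀ n u, HasDerivAt (θ n) (χ n u) u := fun n u =>
    intervalIntegral.integral_hasDerivAt_right ((hχc n).intervalIntegrable _ _)
      ((hχc n).stronglyMeasurableAtFilter _ _) (hχc n).continuousAt
  have hθ0 : ∀ n : ℕ, ∀ u : ℝ, |u| ≤ 1 / (n + 1 : ℝ) → θ n u = 0 := by
    intro n u hu
    have : EqOn (χ n) (fun _ => 0) (uIcc 0 u) := by
      intro v hv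
      apply hχ0
      have := abs_sub_left_of_mem_uIcc hv
      simp only [sub_zero] at this
      exact this.trans hu
    simp only [hθ]
    rw [intervalIntegral.integral_congr this]
    simp
  have hθlim : ∀ u, Tendsto (fun n => θ n u) atTop (𝓝 u) := by
    intro u
    have := intervalIntegral.tendsto_integral_filter_of_dominated_convergence (μ := volume)
      (a := 0) (b := u) (l := atTop) (F := χ) (f := fun _ => (1 : ℝ)) (fun _ => (1 : ℝ))
      (Eventually.of_forall fun n => (hχc n).aestronglyMeasurable)
      (Eventually.of_forall fun n => Eventually.of_forall fun v _ => hχ1 n v)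
      intervalIntegrable_const ?_
    · simpa using this
    · have h0 : ∀ᵐ v : ℝ, v ≠ 0 := by simp [ae_iff, measure_singleton]
      filter_upwards [h0] with v hv _ using hχlim v hv
  have hFTC : ∀ n, ∫ x in a..b, χ n (f x) * f' x = θ n (f b) - θ n (f a) := by
    intro n
    have hθf : ContinuousOn (fun x => θ n (f x)) (Icc a b) := by
      refine Continuous.comp_continuousOn' ?_ hf
      exact continuous_iff_continuousAt.2 fun u => (hθd n u).continuousAt
    refine intervalIntegral.integral_eq_sub_of_hasDerivAt_of_le hab hθf ?_ ?_
    · intro x hx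
      by_cases h : f x = 0
      · have hn : χ n (f x) = 0 := hχ0 n _ (by rw [h, abs_zero]; positivity)
        rw [hn, zero_mul]
        have hev : ∀ᶠ y in 𝓝 x, |f y| < 1 / (n + 1 : ℝ) := by
          have hc : ContinuousAt f x := hf.continuousAt (Icc_mem_nhds hx.1 hx.2)
          have := hc.abs
          exact this.eventually_lt continuousAt_const (by rw [h, abs_zero]; positivity)
        apply (hasDerivAt_const x (0 : ℝ)).congr_of_eventuallyEq
        filter_upwards [hev] with y hy using hθ0 n _ hy.le
      · exact (hθd n (f x)).comp x (hderiv x hx h)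
    · refine hint.continuousOn_mul ?_
      rw [uIcc_of_le hab]
      exact (hχc n).comp_continuousOn' hf
  have hlim : Tendsto (fun n => ∫ x in a..b, χ n (f x) * f' x) atTop (𝓝 (∫ x in a..b, f' x)) := by
    refine intervalIntegral.tendsto_integral_filter_of_dominated_convergence (fun x => ‖f' x‖)
      (Eventually.of_forall fun n => ?_)
      (Eventually.of_forall fun n => Eventually.of_forall fun v _ => ?_) hint.norm ?_
    · refine (hint.continuousOn_mul (f := f') (g := fun x => χ n (f x)) ?_).def'.aestronglyMeasurable
      rw [uIcc_of_le hab]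
      exact (hχc n).comp_continuousOn' hf
    · rw [norm_mul]
      exact mul_le_of_le_one_left (norm_nonneg _) (hχ1 n _)
    · have h0 : ∀ᵐ v : ℝ, v ∉ s := hs.ae_notMem _
      have h1 : ∀ᵐ v : ℝ, v ≠ b := by simp [ae_iff, measure_singleton]
      filter_upwards [h0, h1] with x hx hxb hxI
      rw [uIoc_of_le hab] at hxI
      by_cases h : f x = 0
      · have := hzero x ⟨hxI.1, lt_of_le_of_ne hxI.2 hxb⟩ hx h
        simp [this]
      · simpa using (hχlim _ h).mul_const (f' x)
  refine tendsto_nhds_unique hlim ?_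
  simp only [hFTC]
  exact (hθlim _).sub (hθlim _)

open Set Topology in
theorem nonneg_of_hasDerivAt_of_eventually_ge_right {g : ℝ → ℝ} {g' x : ℝ}
    (hg : HasDerivAt g g' x) (h : ∀ᶠ y in 𝓝[>] x, g x ≤ g y) : 0 ≤ g' := by
  have h1 : Tendsto (slope g x) (𝓝[>] x) (𝓝 g') :=
    (hasDerivAt_iff_tendsto_slope.1 hg).mono_left (nhdsWithin_mono _ fun y hy => ne_of_gt hy)
  refine ge_of_tendsto h1 ?_
  filter_upwards [h, self_mem_nhdsWithin] with y hy hxy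
  rw [slope_def_field]
  exact div_nonneg (sub_nonneg.2 hy) (sub_nonneg.2 (le_of_lt hxy))

open Set Topology in
theorem nonpos_of_hasDerivAt_of_eventually_ge_left {g : ℝ → ℝ} {g' x : ℝ}
    (hg : HasDerivAt g g' x) (h : ∀ᶠ y in 𝓝[<] x, g x ≤ g y) : g' ≤ 0 := by
  have h1 : Tendsto (slope g x) (𝓝[<] x) (𝓝 g') :=
    (hasDerivAt_iff_tendsto_slope.1 hg).mono_left (nhdsWithin_mono _ fun y hy => ne_of_lt hy)
  refine le_of_tendsto h1 ?_
  filter_upwards [h, self_mem_nhdsWithin] with y hy hxy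
  rw [slope_def_field]
  exact div_nonpos_of_nonneg_of_nonpos (sub_nonneg.2 hy) (sub_nonpos.2 (le_of_lt hxy))

open Set Topology in
theorem IsLocalMin.nonneg_of_hasDerivAt_hasDerivAt {g g' : ℝ → ℝ} {g'' x : ℝ}
    (hmin : IsLocalMin g x) (hg : ∀ᶠ y in 𝓝 x, HasDerivAt g (g' y) y)
    (hg' : HasDerivAt g' g'' x) : 0 ≤ g'' := by
  by_contra! hneg
  have h0 : g' x = 0 := hmin.hasDerivAt_eq_zero hg.self_of_nhds
  have h1 : Tendsto (slope g' x) (𝓝[>] x) (𝓝 g'') :=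
    (hasDerivAt_iff_tendsto_slope.1 hg').mono_left (nhdsWithin_mono _ fun y hy => ne_of_gt hy)
  have h2 : ∀ᶠ y in 𝓝[>] x, g' y < 0 := by
    filter_upwards [h1.eventually_lt_const hneg, self_mem_nhdsWithin] with y hy hxy
    rw [slope_def_field, h0, sub_zero, div_lt_iff₀ (sub_pos.2 hxy), zero_mul] at hy
    exact hy
  obtain ⟨y, hy, hsub⟩ := (mem_nhdsGT_iff_exists_Ioc_subset (a := x)).1
    (h2.and ((hmin.filter_mono nhdsWithin_le_nhds).and (hg.filter_mono nhdsWithin_le_nhds)))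
  have hxy : x < y := hy
  have hd : ∀ z ∈ Icc x y, HasDerivAt g (g' z) z := by
    intro z hz
    rcases eq_or_lt_of_le hz.1 with h | h
    · exact h ▸ hg.self_of_nhds
    · exact (hsub ⟨h, hz.2⟩).2.2
  obtain ⟨c, hc, hcs⟩ := exists_hasDerivAt_eq_slope g g' hxy
    (fun z hz => (hd z hz).continuousAt.continuousWithinAt)
    (fun z hz => hd z ⟨hz.1.le, hz.2.le⟩)
  have h3 := (hsub ⟨hc.1, hc.2.le⟩).1
  rw [hcs, div_lt_iff₀ (sub_pos.2 hxy), zero_mul] at h3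
  have h4 := (hsub ⟨hxy, le_rfl⟩).2.1
  linarith

open Set Topology in
set_option maxHeartbeats 1000000 in
/-- A barrier argument: a strictly increasing crossing of the level `u₀` by a solution of a
parabolic equation persists, as a crossing with positive slope, at some later time. -/
theorem exists_level_crossing_of_parabolic {u ux uxx a : ℝ → ℝ → ℝ} {r κ c u₀ xL x₁ xR τ₁ τ₂ : ℝ}
    (hτ : τ₁ < τ₂) (hL : xL < x₁) (hR : x₁ < xR) (hκ : 0 < κ) (hc : 0 < c)
    (hu : ContinuousOn (fun p : ℝ × ℝ => u p.1 p.2) (Icc xL xR ×ˢ Icc τ₁ τ₂))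
    (hux : ∀ x ∈ Ioo xL xR, ∀ τ ∈ Ioo τ₁ τ₂, HasDerivAt (fun y => u y τ) (ux x τ) x)
    (huxx : ∀ x ∈ Ioo xL xR, ∀ τ ∈ Ioo τ₁ τ₂, HasDerivAt (fun y => ux y τ) (uxx x τ) x)
    (hut : ∀ x ∈ Ioo xL xR, ∀ τ ∈ Ioo τ₁ τ₂,
      HasDerivAt (fun t => u x t) (a x τ * uxx x τ + (a x τ + r) * ux x τ) τ)
    (ha : ∀ x ∈ Ioo xL xR, ∀ τ ∈ Ioo τ₁ τ₂, κ ≤ a x τ)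
    (hinit : ∀ x ∈ Icc x₁ xR, u₀ + c * (x - x₁) ≤ u x τ₁) (hleft : u xL τ₁ < u₀) :
    ∃ τ ∈ Ioo τ₁ τ₂, ∃ x ∈ Ioo xL xR, u x τ = u₀ ∧ 0 < ux x τ := by
  have hLR : xL < xR := hL.trans hR
  set d := c * (xR - x₁) / 2 with hd
  have hd0 : 0 < d := by have := sub_pos.2 hR; positivity
  obtain ⟨ε, hε, hετ, hεL, hεR⟩ : ∃ ε > 0, τ₁ + ε < τ₂ ∧
      (∀ τ ∈ Icc τ₁ (τ₁ + ε), u xL τ < u₀) ∧ ∀ τ ∈ Icc τ₁ (τ₁ + ε), u₀ + d < u xR τ := by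
    have hslice : ∀ x ∈ Icc xL xR, ContinuousWithinAt (fun τ => u x τ) (Icc τ₁ τ₂) τ₁ := by
      intro x hx
      have h : ContinuousOn (fun τ => u x τ) (Icc τ₁ τ₂) :=
        hu.comp (f := fun τ => (x, τ)) (by fun_prop) fun τ hτ => ⟨hx, hτ⟩
      exact h _ ⟨le_rfl, hτ.le⟩
    have e1 := (hslice xL ⟨le_rfl, hLR.le⟩).eventually_lt_const hleft
    have e2 := (hslice xR ⟨hLR.le, le_rfl⟩).eventually_const_lt (u := u₀ + d)
      (by have := hinit xR ⟨hR.le, le_rfl⟩; rw [hd] at *; nlinarith [sub_pos.2 hR])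
    have e3 : ∀ᶠ τ in 𝓝[≥] τ₁, τ < τ₂ :=
      nhdsWithin_le_nhds (eventually_lt_nhds hτ)
    have e4 : 𝓝[Icc τ₁ τ₂] τ₁ = 𝓝[≥] τ₁ := nhdsWithin_Icc_eq_nhdsGE hτ
    rw [e4] at e1 e2
    obtain ⟨b, hb, hsub⟩ := (mem_nhdsGE_iff_exists_Icc_subset (a := τ₁)).1 (e1.and (e2.and e3))
    have hb' : τ₁ < b := hb
    refine ⟨b - τ₁, sub_pos.2 hb', ?_, ?_, ?_⟩
    · rw [add_sub_cancel]; exact (hsub ⟨hb'.le, le_rfl⟩).2.2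
    · rw [add_sub_cancel]; exact fun τ h => (hsub h).1
    · rw [add_sub_cancel]; exact fun τ h => (hsub h).2.1
  set s := (x₁ + xR) / 2 with hs
  have hs1 : x₁ < s := by rw [hs]; linarith
  have hs2 : s < xR := by rw [hs]; linarith
  set Λ := (s - xL) / ε with hΛ
  have hΛ0 : 0 < Λ := div_pos (by linarith) hε
  have hΛε : Λ * ε = s - xL := div_mul_cancel₀ _ hε.ne'
  obtain ⟨α, hα0, hα⟩ : ∃ α > 0, Λ < κ * (α + 1) + r := by
    refine ⟨(|Λ - r| + 1) / κ, by positivity, ?_⟩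
    rw [mul_add, mul_div_cancel₀ _ hκ.ne']
    linarith [le_abs_self (Λ - r)]
  have hexp : 0 < rexp (α * (xR - xL)) - 1 := by
    have := Real.add_one_lt_exp (x := α * (xR - xL)) (by have := sub_pos.2 hLR; positivity)
    have h2 : 0 < α * (xR - xL) := by have := sub_pos.2 hLR; positivity
    linarith
  obtain ⟨q, hq0, hqd, hqs⟩ : ∃ q > 0, q * (rexp (α * (xR - xL)) - 1) < d ∧
      q * (rexp (α * (xR - xL)) - 1) < c * (s - x₁) := by
    have hm : 0 < min d (c * (s - x₁)) := lt_min hd0 (mul_pos hc (by linarith))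
    refine ⟨min d (c * (s - x₁)) / 2 / (rexp (α * (xR - xL)) - 1), by positivity, ?_⟩
    rw [div_mul_cancel₀ _ hexp.ne']
    constructor
    · linarith [min_le_left d (c * (s - x₁))]
    · linarith [min_le_right d (c * (s - x₁))]
  set X : ℝ → ℝ := fun τ => s - Λ * (τ - τ₁) with hX
  set v : ℝ → ℝ → ℝ := fun x τ => u₀ + q * (rexp (α * (x - X τ)) - 1) with hv
  have hXL : ∀ τ ≤ τ₁ + ε, xL ≤ X τ := by
    intro τ h
    simp only [hX]
    nlinarith
  have hvle : ∀ x ≤ xR, ∀ τ ≤ τ₁ + ε, v x τ ≤ u₀ + q * (rexp (α * (xR - xL)) - 1) := by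
    intro x hx τ h
    have := hXL τ h
    simp only [hv]
    gcongr
  have hvc : Continuous fun p : ℝ × ℝ => v p.1 p.2 := by simp only [hv, hX]; fun_prop
  have hsubε : Icc τ₁ (τ₁ + ε) ⊆ Icc τ₁ τ₂ := Icc_subset_Icc_right hετ.le
  set K₀ : Set (ℝ × ℝ) := Icc xL xR ×ˢ Icc τ₁ (τ₁ + ε) with hK₀
  have hK₀c : IsCompact K₀ := isCompact_Icc.prod isCompact_Icc
  have huK : ContinuousOn (fun p : ℝ × ℝ => u p.1 p.2) K₀ :=
    hu.mono (prod_mono_right hsubε)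
  set K : Set (ℝ × ℝ) := {p ∈ K₀ | X p.2 ≤ p.1 ∧ u p.1 p.2 ≤ v p.1 p.2} with hK
  have hKc : IsCompact K := by
    have h1 : IsClosed {p ∈ K₀ | u p.1 p.2 ≤ v p.1 p.2} :=
      hK₀c.isClosed.isClosed_le huK hvc.continuousOn
    have h2 : IsClosed {p : ℝ × ℝ | X p.2 ≤ p.1} :=
      isClosed_le (by simp only [hX]; fun_prop) continuous_fst
    refine hK₀c.of_isClosed_subset (t := K) (s := K₀) ?_ (fun p hp => hp.1)
    have : K = {p ∈ K₀ | u p.1 p.2 ≤ v p.1 p.2} ∩ {p : ℝ × ℝ | X p.2 ≤ p.1} := by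
      ext p; simp only [hK, mem_ofPred_eq, mem_inter_iff]; tauto
    rw [this]
    exact h1.inter h2
  have hXε : X (τ₁ + ε) = xL := by simp only [hX, add_sub_cancel_left, hΛε]; ring
  have hKne : K.Nonempty := by
    refine ⟨(xL, τ₁ + ε), ⟨⟨⟨le_rfl, hLR.le⟩, ⟨by linarith, le_rfl⟩⟩, hXε.le, ?_⟩⟩
    simp only [hv, hXε, sub_self, mul_zero, Real.exp_zero, add_zero]
    exact (hεL _ ⟨by linarith, le_rfl⟩).le
  obtain ⟨⟨x, τ⟩, ⟨⟨⟨hxL, hxR⟩, hτ1, hτ2⟩, hXx, huv⟩, hmin⟩ :=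
    hKc.exists_isMinOn hKne continuous_snd.continuousOn
  simp only at hxL hxR hτ1 hτ2 hXx huv
  have hearly : ∀ y t, xL ≤ y → y ≤ xR → τ₁ ≤ t → t < τ → X t ≤ y → v y t < u y t := by
    intro y t h1 h2 h3 h4 h5
    by_contra! h6
    have : (y, t) ∈ K := ⟨⟨⟨h1, h2⟩, h3, (h4.trans_le hτ2).le⟩, h5, h6⟩
    have := hmin this
    simp only [mem_ofPred_eq] at this
    linarith
  have hτ1' : τ₁ < τ := by
    refine lt_of_le_of_ne hτ1 fun h => ?_
    subst h
    have h1 : X τ₁ = s := by simp [hX]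
    rw [h1] at hXx
    have h2 := hinit x ⟨by linarith, hxR⟩
    have h3 := hvle x hxR τ₁ hτ2
    nlinarith
  have hτI : τ ∈ Ioo τ₁ τ₂ := ⟨hτ1', by linarith⟩
  have hxR' : x < xR := by
    refine lt_of_le_of_ne hxR fun h => ?_
    subst h
    have h1 := hεR τ ⟨hτ1, hτ2⟩
    have h3 := hvle x le_rfl τ hτ2
    linarith
  have hge : ∀ y, X τ ≤ y → y < xR → v y τ ≤ u y τ := by
    intro y hy1 hy2
    have hyL := (hXL τ hτ2).trans hy1
    have hγ : Tendsto (fun t => (y + Λ * (τ - t), t)) (𝓝[<] τ) (𝓝[K₀] (y, τ)) := by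
      refine tendsto_nhdsWithin_iff.2 ⟨?_, ?_⟩
      · have : Continuous fun t : ℝ => (y + Λ * (τ - t), t) := by fun_prop
        have := this.tendsto τ
        simp only [sub_self, mul_zero, add_zero] at this
        exact this.mono_left nhdsWithin_le_nhds
      · have e1 : ∀ᶠ t in 𝓝[<] τ, y + Λ * (τ - t) < xR := by
          have : Continuous fun t : ℝ => y + Λ * (τ - t) := by fun_prop
          exact nhdsWithin_le_nhds (this.continuousAt.eventually_lt_const (by simpa using hy2))
        have e2 : ∀ᶠ t in 𝓝[<] τ, τ₁ < t := nhdsWithin_le_nhds (eventually_gt_nhds hτ1')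
        filter_upwards [e1, e2, self_mem_nhdsWithin] with t h1 h2 h3
        have h3 : t < τ := h3
        exact ⟨⟨by nlinarith, h1.le⟩, h2.le, by linarith⟩
    have h1 : Tendsto (fun t => u (y + Λ * (τ - t)) t) (𝓝[<] τ) (𝓝 (u y τ)) :=
      (huK (y, τ) ⟨⟨hyL, hy2.le⟩, hτ1, hτ2⟩).tendsto.comp hγ
    refine ge_of_tendsto h1 ?_
    have e1 : ∀ᶠ t in 𝓝[<] τ, y + Λ * (τ - t) < xR := by
      have : Continuous fun t : ℝ => y + Λ * (τ - t) := by fun_prop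
      exact nhdsWithin_le_nhds (this.continuousAt.eventually_lt_const (by simpa using hy2))
    have e2 : ∀ᶠ t in 𝓝[<] τ, τ₁ < t := nhdsWithin_le_nhds (eventually_gt_nhds hτ1')
    filter_upwards [e1, e2, self_mem_nhdsWithin] with t h1 h2 h3
    have h3 : t < τ := h3
    have h4 : X t = X τ + Λ * (τ - t) := by simp only [hX]; ring
    have h5 := hearly (y + Λ * (τ - t)) t (by nlinarith) h1.le h2.le h3 (by rw [h4]; linarith)
    have h6 : v (y + Λ * (τ - t)) t = v y τ := by simp only [hv, h4]; ring_nf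
    linarith
  have huv' : u x τ = v x τ := le_antisymm huv (hge x hXx hxR')
  rcases eq_or_lt_of_le hXx with hXeq | hXlt
  · have hu0 : u x τ = u₀ := by
      rw [huv']; simp [hv, hXeq]
    have hxL' : xL < x := by
      refine lt_of_le_of_ne hxL fun h => ?_
      have := hεL τ ⟨hτ1, hτ2⟩
      rw [h, hu0] at this
      exact lt_irrefl _ this
    refine ⟨τ, hτI, x, ⟨hxL', hxR'⟩, hu0, ?_⟩
    have hvx : HasDerivAt (fun y => v y τ) (q * (rexp (α * (x - X τ)) * (α * 1))) x := by
      simp only [hv]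
      exact (((((hasDerivAt_id x).sub_const (X τ)).const_mul α).exp.sub_const 1).const_mul q).const_add u₀
    have h1 := (hux x ⟨hxL', hxR'⟩ τ hτI).sub hvx
    have h2 := nonneg_of_hasDerivAt_of_eventually_ge_right h1 (by
      filter_upwards [Ioo_mem_nhdsGT hxR'] with y hy
      simp only [Pi.sub_apply, huv', sub_self]
      exact sub_nonneg.2 (hge y (by linarith [hy.1]) hy.2))
    have h3 : 0 < q * (rexp (α * (x - X τ)) * (α * 1)) := by positivity
    linarith
  · exfalso
    have hxI : x ∈ Ioo xL xR := ⟨(hXL τ hτ2).trans_lt hXlt, hxR'⟩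
    have hvx : ∀ y, HasDerivAt (fun y => v y τ) (q * (rexp (α * (y - X τ)) * (α * 1))) y := by
      intro y
      simp only [hv]
      exact (((((hasDerivAt_id y).sub_const (X τ)).const_mul α).exp.sub_const 1).const_mul q).const_add u₀
    have hvxx : HasDerivAt (fun y => q * (rexp (α * (y - X τ)) * (α * 1)))
        (q * (rexp (α * (x - X τ)) * (α * 1) * (α * 1))) x :=
      (((((hasDerivAt_id x).sub_const (X τ)).const_mul α).exp).mul_const _).const_mul q
    have hvt : HasDerivAt (fun t => v x t) (q * (rexp (α * (x - X τ)) * (α * Λ))) τ := by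
      have h1 : HasDerivAt X (-(Λ * 1)) τ :=
        (((hasDerivAt_id τ).sub_const τ₁).const_mul Λ).const_sub s
      have h2 := ((((h1.const_sub x).const_mul α).exp.sub_const 1).const_mul q).const_add u₀
      simpa [hv] using h2
    have hlm : IsLocalMin (fun y => u y τ - v y τ) x := by
      filter_upwards [Ioo_mem_nhds hXlt hxR'] with y hy
      rw [huv', sub_self]
      exact sub_nonneg.2 (hge y hy.1.le hy.2)
    have hd1 : ∀ᶠ y in 𝓝 x, HasDerivAt (fun y => u y τ - v y τ)
        (ux y τ - q * (rexp (α * (y - X τ)) * (α * 1))) y := by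
      filter_upwards [Ioo_mem_nhds hxI.1 hxI.2] with y hy
      exact (hux y hy τ hτI).sub (hvx y)
    have hx0 := hlm.hasDerivAt_eq_zero hd1.self_of_nhds
    have hxx0 := hlm.nonneg_of_hasDerivAt_hasDerivAt hd1 ((huxx x hxI τ hτI).sub hvxx)
    have ht0 := nonpos_of_hasDerivAt_of_eventually_ge_left ((hut x hxI τ hτI).sub hvt) (by
      have e1 : ∀ᶠ t in 𝓝[<] τ, X t < x := by
        have : Continuous X := by simp only [hX]; fun_prop
        exact nhdsWithin_le_nhds (this.continuousAt.eventually_lt_const hXlt)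
      have e2 : ∀ᶠ t in 𝓝[<] τ, τ₁ < t := nhdsWithin_le_nhds (eventually_gt_nhds hτ1')
      filter_upwards [e1, e2, self_mem_nhdsWithin] with t h1 h2 h3
      simp only [Pi.sub_apply, huv', sub_self]
      exact sub_nonneg.2 (hearly x t hxL hxR h2.le h3 h1.le).le)
    have haκ := ha x hxI τ hτI
    set e := rexp (α * (x - X τ)) with he
    have he0 : 0 < e := Real.exp_pos _
    have hκa : κ * (α + 1) ≤ a x τ * (α + 1) := by gcongr
    have h5 : ux x τ = q * α * e := by linarith
    have h6 : a x τ * (q * α * e * α) ≤ a x τ * uxx x τ := by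
      apply mul_le_mul_of_nonneg_left _ (hκ.le.trans haκ)
      linarith
    rw [h5] at ht0
    have h7 : q * α * e * (a x τ * (α + 1) + r - Λ) ≤ 0 := by
      have h9 : q * α * e * (a x τ * (α + 1) + r - Λ) =
          a x τ * (q * α * e * α) + (a x τ + r) * (q * α * e) - q * (e * (α * Λ)) := by ring
      linarith
    have h8 : 0 < q * α * e * (a x τ * (α + 1) + r - Λ) := by
      apply mul_pos (by positivity); linarith
    linarith

open Set Topology in
theorem hasDerivAt_mul_of_continuousAt_of_eq_zero {f g : ℝ → ℝ} {g' x : ℝ}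
    (hf : ContinuousAt f x) (hg : HasDerivAt g g' x) (h0 : g x = 0) :
    HasDerivAt (fun y => f y * g y) (f x * g') x := by
  rw [hasDerivAt_iff_tendsto_slope] at hg ⊢
  have h1 : Tendsto (fun y => f y * slope g x y) (𝓝[≠] x) (𝓝 (f x * g')) :=
    (hf.tendsto.mono_left nhdsWithin_le_nhds).mul hg
  refine h1.congr fun y => ?_
  simp only [slope_def_field, h0]
  ring

open Set Topology in
theorem differentiableAt_of_comp_mul_deriv {φ h : ℝ → ℝ} {x : ℝ} (hh : ContDiff ℝ 2 h)
    (hx : deriv h x ≠ 0) (hd : DifferentiableAt ℝ (fun y => φ (h y) * deriv h y) x) :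
    DifferentiableAt ℝ φ (h x) := by
  have hh1 : HasStrictDerivAt h (deriv h x) x :=
    (hh.contDiffAt.hasStrictDerivAt (by norm_num))
  have hh2 : Differentiable ℝ (deriv h) :=
    (hh.iterate_deriv' 1 1).differentiable (by norm_num)
  have h1 : DifferentiableAt ℝ (fun y => φ (h y)) x := by
    refine (hd.div (hh2 x) hx).congr_of_eventuallyEq ?_
    filter_upwards [hh2.continuous.continuousAt.eventually_ne hx] with y hy
    simp [hy]
  set g := hh1.localInverse h (deriv h x) x hx with hg
  have hgd := (hh1.to_localInverse hx).hasDerivAt.differentiableAt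
  have hgx : g (h x) = x := (hh1.eventually_left_inverse hx).self_of_nhds
  have hr := hh1.eventually_right_inverse hx
  have h2 : DifferentiableAt ℝ (fun z => φ (h (g z))) (h x) :=
    DifferentiableAt.comp (h x) (g := fun y => φ (h y)) (by rw [hgx]; exact h1) hgd
  refine h2.congr_of_eventuallyEq ?_
  filter_upwards [hr] with z hz
  rw [hz]

/-- Smooth solutions of the Gamma equation
`∂_τ H = ∂²_x β(H) + ∂_x β(H) + r ∂_x H` on `ℝ × (0, T)`. -/
structure IsGammaSolution (β : ℝ → ℝ) (r T : ℝ) (H : ℝ → ℝ → ℝ) : Prop where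
  contDiff_nonlinearity : ContDiff ℝ 1 β
  continuousOn : ContinuousOn (fun p : ℝ × ℝ => H p.1 p.2) (Set.univ ×ˢ Set.Ioo 0 T)
  contDiff_space : ∀ τ ∈ Set.Ioo (0 : ℝ) T, ContDiff ℝ 2 fun x => H x τ
  differentiableAt_time : ∀ x : ℝ, ∀ τ ∈ Set.Ioo (0 : ℝ) T,
    DifferentiableAt ℝ (fun t => H x t) τ
  deriv_time_eq : ∀ x : ℝ, ∀ τ ∈ Set.Ioo (0 : ℝ) T,
    deriv (fun t => H x t) τ
      = deriv (deriv fun y => β (H y τ)) x + deriv (fun y => β (H y τ)) x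
        + r * deriv (fun y => H y τ) x

namespace IsGammaSolution

open Set Topology

variable {β : ℝ → ℝ} {r T : ℝ} {H : ℝ → ℝ → ℝ}

theorem hasDerivAt_nonlinearity (hs : IsGammaSolution β r T H) (y : ℝ) : HasDerivAt β (deriv β y) y :=
  (hs.contDiff_nonlinearity.differentiable (by norm_num) y).hasDerivAt

theorem continuous_deriv_nonlinearity (hs : IsGammaSolution β r T H) : Continuous (deriv β) :=
  hs.contDiff_nonlinearity.continuous_deriv le_rfl

theorem hasDerivAt_space (hs : IsGammaSolution β r T H) {τ : ℝ}
    (hτ : τ ∈ Ioo (0 : ℝ) T) (x : ℝ) :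
    HasDerivAt (fun y => H y τ) (deriv (fun y => H y τ) x) x :=
  ((hs.contDiff_space τ hτ).differentiable (by norm_num) x).hasDerivAt

theorem continuous_space (hs : IsGammaSolution β r T H) {τ : ℝ}
    (hτ : τ ∈ Ioo (0 : ℝ) T) : Continuous fun x => H x τ := (hs.contDiff_space τ hτ).continuous

theorem differentiable_deriv_space (hs : IsGammaSolution β r T H) {τ : ℝ}
    (hτ : τ ∈ Ioo (0 : ℝ) T) : Differentiable ℝ (deriv fun y => H y τ) :=
  ((hs.contDiff_space τ hτ).iterate_deriv' 1 1).differentiable (by norm_num)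

theorem continuous_deriv_space (hs : IsGammaSolution β r T H) {τ : ℝ}
    (hτ : τ ∈ Ioo (0 : ℝ) T) : Continuous (deriv fun y => H y τ) :=
  (hs.differentiable_deriv_space hτ).continuous

theorem hasDerivAt_comp_space (hs : IsGammaSolution β r T H) {τ : ℝ}
    (hτ : τ ∈ Ioo (0 : ℝ) T) (x : ℝ) :
    HasDerivAt (fun y => β (H y τ)) (deriv β (H x τ) * deriv (fun y => H y τ) x) x :=
  (hs.hasDerivAt_nonlinearity (H x τ)).comp x (hs.hasDerivAt_space hτ x)

theorem deriv_comp_space (hs : IsGammaSolution β r T H) {τ : ℝ}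
    (hτ : τ ∈ Ioo (0 : ℝ) T) :
    (deriv fun y => β (H y τ)) = fun x => deriv β (H x τ) * deriv (fun y => H y τ) x :=
  funext fun x => (hs.hasDerivAt_comp_space hτ x).deriv

theorem continuous_deriv_comp_space (hs : IsGammaSolution β r T H) {τ : ℝ}
    (hτ : τ ∈ Ioo (0 : ℝ) T) : Continuous (deriv fun y => β (H y τ)) := by
  rw [hs.deriv_comp_space hτ]
  exact (hs.continuous_deriv_nonlinearity.comp (hs.continuous_space hτ)).mul
    (hs.continuous_deriv_space hτ)

theorem differentiableAt_flux_of_deriv_eq_zero (hs : IsGammaSolution β r T H) {τ : ℝ}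
    (hτ : τ ∈ Ioo (0 : ℝ) T) {x : ℝ} (hx : deriv (fun y => H y τ) x = 0) :
    DifferentiableAt ℝ (deriv fun y => β (H y τ)) x := by
  rw [hs.deriv_comp_space hτ]
  exact (hasDerivAt_mul_of_continuousAt_of_eq_zero
    (hs.continuous_deriv_nonlinearity.comp (hs.continuous_space hτ)).continuousAt
    (hs.differentiable_deriv_space hτ x).hasDerivAt hx).differentiableAt

theorem differentiableAt_flux_iff (hs : IsGammaSolution β r T H) {τ : ℝ}
    (hτ : τ ∈ Ioo (0 : ℝ) T) {x : ℝ} (hx : deriv (fun y => H y τ) x ≠ 0) :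
    DifferentiableAt ℝ (deriv fun y => β (H y τ)) x ↔ DifferentiableAt ℝ (deriv β) (H x τ) := by
  rw [hs.deriv_comp_space hτ]
  refine ⟨fun h => differentiableAt_of_comp_mul_deriv (φ := deriv β)
    (h := fun y => H y τ) (hs.contDiff_space τ hτ) hx h, fun h => ?_⟩
  exact (h.comp x (hs.hasDerivAt_space hτ x).differentiableAt).mul
    (hs.differentiable_deriv_space hτ x)

theorem hasDerivAt_time (hs : IsGammaSolution β r T H) {τ : ℝ}
    (hτ : τ ∈ Ioo (0 : ℝ) T) (x : ℝ) :
    HasDerivAt (fun t => H x t) (deriv (deriv fun y => β (H y τ)) x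
      + deriv (fun y => β (H y τ)) x + r * deriv (fun y => H y τ) x) τ :=
  hs.deriv_time_eq x τ hτ ▸ (hs.differentiableAt_time x τ hτ).hasDerivAt

theorem neg (hs : IsGammaSolution β r T H) :
    IsGammaSolution (fun y => -β (-y)) r T (fun x τ => -H x τ) where
  contDiff_nonlinearity := (hs.contDiff_nonlinearity.comp contDiff_neg).neg
  continuousOn := hs.continuousOn.neg
  contDiff_space τ hτ := (hs.contDiff_space τ hτ).neg
  differentiableAt_time x τ hτ := (hs.differentiableAt_time x τ hτ).neg
  deriv_time_eq x τ hτ := by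
    have h1 : (deriv fun y => -β (H y τ)) = fun y => -deriv (fun y => β (H y τ)) y := by
      ext y; exact deriv.fun_neg
    simp only [neg_neg]
    rw [h1, deriv.fun_neg, deriv.fun_neg, deriv.fun_neg, hs.deriv_time_eq x τ hτ]
    ring

theorem reverse (hs : IsGammaSolution β r T H) :
    IsGammaSolution (fun y => -β y) (-r) T (fun x τ => H x (T - τ)) where
  contDiff_nonlinearity := hs.contDiff_nonlinearity.neg
  continuousOn := by
    refine hs.continuousOn.comp (f := fun p : ℝ × ℝ => (p.1, T - p.2)) (by fun_prop) ?_
    rintro ⟨x, τ⟩ ⟨-, h⟩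
    exact ⟨mem_univ _, by simp only [mem_Ioo] at h ⊢; constructor <;> linarith⟩
  contDiff_space τ hτ := hs.contDiff_space _ ⟨by linarith [hτ.2], by linarith [hτ.1]⟩
  differentiableAt_time x τ hτ :=
    DifferentiableAt.comp τ (g := fun t => H x t) (f := fun t => T - t)
      (hs.differentiableAt_time x (T - τ) ⟨by linarith [hτ.2], by linarith [hτ.1]⟩) (by fun_prop)
  deriv_time_eq x τ hτ := by
    have h1 : (deriv fun y => -β (H y (T - τ))) = fun y => -deriv (fun y => β (H y (T - τ))) y := by
      ext y; exact deriv.fun_neg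
    rw [h1, deriv.fun_neg, deriv_comp_const_sub (f := fun t => H x t),
      hs.deriv_time_eq x (T - τ) ⟨by linarith [hτ.2], by linarith [hτ.1]⟩]
    ring

end IsGammaSolution

open Set Topology in
theorem IsGδ.exists_portion_subset {B : Set ℝ} (hB : IsGδ B) (hne : B.Nonempty) {A : ℕ → Set ℝ}
    (hA : ∀ n, IsClosed {τ : B | (τ : ℝ) ∈ A n}) (hcov : ∀ τ ∈ B, ∃ n, τ ∈ A n) :
    ∃ n, ∃ J : Set ℝ, IsOpen J ∧ (J ∩ B).Nonempty ∧ J ∩ B ⊆ A n := by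
  have := hB.baireSpace_of_t2Space_locallyCompactSpace
  have := hne.to_subtype
  obtain ⟨n, x, hx⟩ := nonempty_interior_of_iUnion_of_closed hA (by
    ext τ
    simpa using hcov τ τ.2)
  obtain ⟨J, hJ, hJe⟩ := isOpen_induced_iff.1 (isOpen_interior (s := {τ : B | (τ : ℝ) ∈ A n}))
  refine ⟨n, J, hJ, ⟨x, ?_, x.2⟩, ?_⟩
  · rw [← hJe] at hx; exact hx
  · rintro τ ⟨h1, h2⟩
    have h3 : (⟨τ, h2⟩ : B) ∈ interior {τ : B | (τ : ℝ) ∈ A n} := by rw [← hJe]; exact h1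
    have h4 : (⟨τ, h2⟩ : B) ∈ {τ : B | (τ : ℝ) ∈ A n} := interior_subset h3
    exact h4

open Set Topology in
theorem abs_sub_sub_deriv_mul_le {h : ℝ → ℝ} (hh : ContDiff ℝ 2 h) {n a b : ℝ}
    (hn : ∀ x ∈ Icc a b, |deriv (deriv h) x| ≤ n) {x y : ℝ} (hx : x ∈ Icc a b) (hy : y ∈ Icc a b) :
    |h y - h x - deriv h x * (y - x)| ≤ n * (y - x) ^ 2 := by
  have hd : ∀ z, HasDerivAt h (deriv h z) z := fun z =>
    (hh.differentiable (by norm_num) z).hasDerivAt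
  have hd2 : ∀ z, HasDerivAt (deriv h) (deriv (deriv h) z) z := fun z =>
    ((hh.iterate_deriv' 1 1).differentiable (by norm_num) z).hasDerivAt
  have hsub : uIcc x y ⊆ Icc a b := uIcc_subset_Icc hx hy
  have hn0 : 0 ≤ n := (abs_nonneg _).trans (hn x hx)
  have h1 : ∀ z ∈ uIcc x y, ‖deriv h z - deriv h x‖ ≤ n * |y - x| := by
    intro z hz
    have := (convex_Icc a b).norm_image_sub_le_of_norm_hasDerivWithin_le
      (fun z _ => (hd2 z).hasDerivWithinAt) hn hx (hsub hz)
    refine this.trans ?_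
    gcongr
    exact abs_sub_left_of_mem_uIcc hz
  have h2 := (convex_uIcc x y).norm_image_sub_le_of_norm_hasDerivWithin_le
    (f := fun z => h z - deriv h x * z) (f' := fun z => deriv h z - deriv h x * 1)
    (fun z _ => ((hd z).sub ((hasDerivAt_id z).const_mul _)).hasDerivWithinAt)
    (by simpa using h1) left_mem_uIcc right_mem_uIcc
  rw [Real.norm_eq_abs, Real.norm_eq_abs, mul_assoc, abs_mul_abs_self] at h2
  calc _ = |h y - deriv h x * y - (h x - deriv h x * x)| := by congr 1; ring
    _ ≤ _ := h2.trans_eq (by ring)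

open Set Topology in
theorem deriv_deriv_le_of_second_difference_le {h : ℝ → ℝ} (hh : ContDiff ℝ 2 h) {n x : ℝ}
    (hn : ∀ᶠ d in 𝓝 (0 : ℝ), h (x + d) + h (x - d) - 2 * h x ≤ n * d ^ 2) :
    deriv (deriv h) x ≤ n := by
  have hd : ∀ z, HasDerivAt h (deriv h z) z := fun z =>
    (hh.differentiable (by norm_num) z).hasDerivAt
  have hd2 : ∀ z, HasDerivAt (deriv h) (deriv (deriv h) z) z := fun z =>
    ((hh.iterate_deriv' 1 1).differentiable (by norm_num) z).hasDerivAt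
  set g : ℝ → ℝ := fun d => n * d ^ 2 - (h (x + d) + h (x - d) - 2 * h x) with hg
  have hmin : IsLocalMin g 0 := by
    filter_upwards [hn] with d hd
    have h0 : g 0 = 0 := by simp only [hg, add_zero, sub_zero]; ring
    change g 0 ≤ n * d ^ 2 - (h (x + d) + h (x - d) - 2 * h x)
    linarith
  have h1 : ∀ d, HasDerivAt g (n * (2 * d) - (deriv h (x + d) - deriv h (x - d))) d := by
    intro d
    have e1 := (hd (x + d)).comp_const_add x d
    have e2 := (hd (x - d)).comp_const_sub x d
    have e3 := (((hasDerivAt_id d).pow 2).const_mul n).sub ((e1.add e2).sub_const (2 * h x))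
    exact (show HasDerivAt g _ d from e3).congr_deriv (by norm_num [sub_eq_add_neg])
  have h2 : HasDerivAt (fun d => n * (2 * d) - (deriv h (x + d) - deriv h (x - d)))
      (n * (2 * 1) - (deriv (deriv h) (x + 0) - -deriv (deriv h) (x - 0))) 0 := by
    have e1 := (hd2 (x + 0)).comp_const_add x 0
    have e2 := (hd2 (x - 0)).comp_const_sub x 0
    exact (((hasDerivAt_id (0 : ℝ)).const_mul 2).const_mul n).sub (e1.sub e2)
  have h3 := hmin.nonneg_of_hasDerivAt_hasDerivAt (Eventually.of_forall h1) h2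
  simp only [add_zero, sub_zero] at h3
  linarith

namespace IsGammaSolution

open Set Topology

variable {β : ℝ → ℝ} {r T : ℝ} {H : ℝ → ℝ → ℝ}

theorem continuousOn_time (hs : IsGammaSolution β r T H) (x : ℝ) :
    ContinuousOn (fun τ => H x τ) (Ioo 0 T) :=
  hs.continuousOn.comp (f := fun τ => (x, τ)) (by fun_prop) fun _ hτ => ⟨mem_univ _, hτ⟩

/-- On a relatively closed set of times, a solution has locally bounded second space derivative on
a nonempty portion. -/
theorem exists_portion_bounded (hs : IsGammaSolution β r T H) {B : Set ℝ} (hB : IsGδ B)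
    (hBT : B ⊆ Ioo 0 T) (hne : B.Nonempty) (M : ℝ) :
    ∃ n : ℝ, ∃ J : Set ℝ, IsOpen J ∧ (J ∩ B).Nonempty ∧
      ∀ τ ∈ J ∩ B, ∀ x ∈ Icc (-M) M, |deriv (deriv fun y => H y τ) x| ≤ n := by
  set A : ℕ → Set ℝ := fun n => {τ | ∀ x d : ℝ, x ∈ Icc (-(M + 1)) (M + 1) → d ∈ Icc (-1 : ℝ) 1 →
    |H (x + d) τ + H (x - d) τ - 2 * H x τ| ≤ n * d ^ 2} with hAdef
  have hcont : ∀ x, Continuous fun τ : B => H x τ := fun x =>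
    continuousOn_iff_continuous_domRestrict.1 ((hs.continuousOn_time x).mono hBT)
  obtain ⟨n, J, hJ, hJB, hsub⟩ := hB.exists_portion_subset hne (A := A) (fun n => by
    have h1 : {τ : B | (τ : ℝ) ∈ A n} = ⋂ (x : ℝ) (d : ℝ)
        (_ : x ∈ Icc (-(M + 1)) (M + 1)) (_ : d ∈ Icc (-1 : ℝ) 1),
        {τ : B | |H (x + d) τ + H (x - d) τ - 2 * H x τ| ≤ n * d ^ 2} := by
      ext τ
      simp only [hAdef, mem_ofPred_eq, mem_iInter]
    rw [h1]
    refine isClosed_iInter fun x => isClosed_iInter fun d => isClosed_iInter fun _ =>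
      isClosed_iInter fun _ => isClosed_le ?_ continuous_const
    exact (((hcont _).add (hcont _)).sub (continuous_const.mul (hcont _))).abs) (fun τ hτ => by
    have hc : Continuous (deriv (deriv fun y => H y τ)) :=
      ((hs.contDiff_space τ (hBT hτ)).iterate_deriv' 0 2).continuous
    obtain ⟨C, hC⟩ := isCompact_Icc.exists_bound_of_continuousOn
      (s := Icc (-(M + 2)) (M + 2)) hc.continuousOn
    obtain ⟨n, hn⟩ := exists_nat_ge (2 * C)
    refine ⟨n, fun x d hx hd => ?_⟩
    have h0 : x ∈ Icc (-(M + 2)) (M + 2) := ⟨by linarith [hx.1], by linarith [hx.2]⟩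
    have h1 := abs_sub_sub_deriv_mul_le (hs.contDiff_space τ (hBT hτ)) hC h0
      (y := x + d) ⟨by linarith [hx.1, hd.1], by linarith [hx.2, hd.2]⟩
    have h2 := abs_sub_sub_deriv_mul_le (hs.contDiff_space τ (hBT hτ)) hC h0
      (y := x - d) ⟨by linarith [hx.1, hd.2], by linarith [hx.2, hd.1]⟩
    rw [abs_le] at h1 h2 ⊢
    constructor <;> nlinarith [sq_nonneg d])
  refine ⟨n, J, hJ, hJB, fun τ hτ x hx => ?_⟩
  have hc2 := hs.contDiff_space τ (hBT hτ.2)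
  have hev : ∀ᶠ d in 𝓝 (0 : ℝ), |H (x + d) τ + H (x - d) τ - 2 * H x τ| ≤ n * d ^ 2 := by
    filter_upwards [Icc_mem_nhds (show (-1 : ℝ) < 0 by norm_num) one_pos] with d hd
    exact hsub hτ x d ⟨by linarith [hx.1], by linarith [hx.2]⟩ hd
  rw [abs_le]
  constructor
  · have := deriv_deriv_le_of_second_difference_le (x := x) (n := n) hc2.neg (by
      filter_upwards [hev] with d hd
      rw [abs_le] at hd
      linarith)
    have h1 : (deriv fun y => -H y τ) = fun y => -deriv (fun y => H y τ) y := by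
      ext y; exact deriv.fun_neg
    rw [h1, deriv.fun_neg] at this
    linarith
  · exact deriv_deriv_le_of_second_difference_le hc2 (by
      filter_upwards [hev] with d hd
      exact (abs_le.1 hd).2)

theorem continuousOn_deriv_space_of_bounded (hs : IsGammaSolution β r T H) {B : Set ℝ}
    (hBT : B ⊆ Ioo 0 T) {n a b : ℝ}
    (hn : ∀ τ ∈ B, ∀ x ∈ Icc a b, |deriv (deriv fun y => H y τ) x| ≤ n) :
    ContinuousOn (fun p : ℝ × ℝ => deriv (fun y => H y p.2) p.1) (Ioo a b ×ˢ B) := by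
  have hC : ∀ x ∈ Ioo a b, ∃ n' : ℝ, 0 < n' ∧ n ≤ n' := fun x _ =>
    ⟨|n| + 1, by positivity, by linarith [le_abs_self n]⟩
  refine continuousOn_of_locally_uniform_approx_of_continuousWithinAt ?_
  rintro ⟨x, τ⟩ ⟨hx, hτ⟩ u hu
  obtain ⟨ε, hε, hεu⟩ := Metric.mem_uniformity_dist.1 hu
  obtain ⟨m, hm0, hm⟩ := hC x hx
  obtain ⟨d, hd0, hdb, hdε⟩ : ∃ d > 0, x + 2 * d < b ∧ m * d < ε := by
    have h1 : 0 < min ((b - x) / 2) (ε / m) := lt_min (by linarith [hx.2]) (by positivity)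
    refine ⟨min ((b - x) / 2) (ε / m) / 2, by positivity, ?_, ?_⟩
    · linarith [min_le_left ((b - x) / 2) (ε / m)]
    · have := min_le_right ((b - x) / 2) (ε / m)
      calc m * (min ((b - x) / 2) (ε / m) / 2) ≤ m * (ε / m / 2) := by gcongr
        _ = ε / 2 := by field_simp
        _ < ε := by linarith
  refine ⟨Ioo a (x + d) ×ˢ B, ?_, fun p => (H (p.1 + d) p.2 - H p.1 p.2) / d, ?_, ?_⟩
  · refine mem_nhdsWithin.2 ⟨Iio (x + d) ×ˢ univ, isOpen_Iio.prod isOpen_univ,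
      ⟨by simp [hd0], mem_univ _⟩, ?_⟩
    rintro ⟨y, t⟩ ⟨⟨h1, -⟩, ⟨h2, h3⟩⟩
    exact ⟨⟨h2.1, h1⟩, h3⟩
  · have hHc : ContinuousOn (fun p : ℝ × ℝ => H p.1 p.2) (univ ×ˢ B) :=
      hs.continuousOn.mono (prod_mono_right hBT)
    have h1 : ContinuousOn (fun p : ℝ × ℝ => (H (p.1 + d) p.2 - H p.1 p.2) / d) (univ ×ˢ B) :=
      ((hHc.comp (f := fun p : ℝ × ℝ => (p.1 + d, p.2)) (by fun_prop)
        fun p hp => ⟨mem_univ _, hp.2⟩).sub hHc).div_const d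
    exact (h1 _ ⟨mem_univ _, hτ⟩).mono (prod_mono_left (subset_univ _))
  · rintro ⟨y, t⟩ ⟨hy, ht⟩
    apply hεu
    have h1 := abs_sub_sub_deriv_mul_le (hs.contDiff_space t (hBT ht)) (hn t ht)
      (x := y) (y := y + d) ⟨hy.1.le, by linarith [hy.2]⟩ ⟨by linarith [hy.1], by linarith [hy.2]⟩
    simp only [add_sub_cancel_left] at h1
    rw [dist_comm, Real.dist_eq]
    simp only
    have h2 : (H (y + d) t - H y t) / d - deriv (fun y => H y t) y
        = (H (y + d) t - H y t - deriv (fun y => H y t) y * d) / d := by field_simp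
    rw [h2, abs_div, abs_of_pos hd0, div_lt_iff₀ hd0]
    calc _ ≤ n * d ^ 2 := h1
      _ ≤ m * d ^ 2 := by gcongr
      _ = m * d * d := by ring
      _ < ε * d := by gcongr

end IsGammaSolution

open Set Topology in
set_option maxHeartbeats 1000000 in
/-- Level curves of a function which is strictly increasing in its first variable. -/
theorem exists_level_curves {H Hx : ℝ → ℝ → ℝ} {x₁ x₂ t₁ t₂ ym yp c : ℝ} (hx : x₁ < x₂)
    (hc0 : 0 < c)
    (hd : ∀ t ∈ Icc t₁ t₂, ∀ x ∈ Icc x₁ x₂, HasDerivAt (fun x => H x t) (Hx x t) x)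
    (hc : ∀ t ∈ Icc t₁ t₂, ∀ x ∈ Icc x₁ x₂, c ≤ Hx x t)
    (hHt : ∀ x ∈ Icc x₁ x₂, ContinuousOn (fun t => H x t) (Icc t₁ t₂))
    (hHx : ContinuousOn (fun p : ℝ × ℝ => Hx p.1 p.2) (Icc x₁ x₂ ×ˢ Icc t₁ t₂))
    (h1 : ∀ t ∈ Icc t₁ t₂, H x₁ t < ym) (h2 : ∀ t ∈ Icc t₁ t₂, yp < H x₂ t) :
    ∃ X : ℝ → ℝ → ℝ,
      (∀ y ∈ Icc ym yp, ∀ t ∈ Icc t₁ t₂, X y t ∈ Ioo x₁ x₂ ∧ H (X y t) t = y) ∧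
      (∀ y ∈ Icc ym yp, ∀ z ∈ Icc ym yp, ∀ t ∈ Icc t₁ t₂, |X y t - X z t| ≤ |y - z| / c) ∧
      (∀ y ∈ Icc ym yp, ContinuousOn (fun t => X y t) (Icc t₁ t₂)) ∧
      (∀ y ∈ Ioo ym yp, ∀ t ∈ Icc t₁ t₂, HasDerivAt (fun z => X z t) (Hx (X y t) t)⁻¹ y) ∧
      ∀ y ∈ Icc ym yp, ∀ t ∈ Ioo t₁ t₂, ∀ d, HasDerivAt (fun s => H (X y t) s) d t →
        HasDerivAt (fun s => X y s) (-d / Hx (X y t) t) t := by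
  have hex : ∀ y t, ∃ x, y ∈ Icc ym yp → t ∈ Icc t₁ t₂ → x ∈ Ioo x₁ x₂ ∧ H x t = y := by
    intro y t
    by_cases h : y ∈ Icc ym yp ∧ t ∈ Icc t₁ t₂
    · obtain ⟨x, hx', hxy⟩ := intermediate_value_Ioo hx.le
        (fun x hx => (hd t h.2 x hx).continuousAt.continuousWithinAt)
        ⟨(h1 t h.2).trans_le h.1.1, h.1.2.trans_lt (h2 t h.2)⟩
      exact ⟨x, fun _ _ => ⟨hx', hxy⟩⟩
    · exact ⟨0, fun h3 h4 => absurd ⟨h3, h4⟩ h⟩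
  choose X hX using hex
  have hmvt : ∀ t ∈ Icc t₁ t₂, ∀ x ∈ Icc x₁ x₂, ∀ z ∈ Icc x₁ x₂, ∃ ξ ∈ uIcc x z,
      H z t - H x t = Hx ξ t * (z - x) := by
    have key : ∀ t ∈ Icc t₁ t₂, ∀ x ∈ Icc x₁ x₂, ∀ z ∈ Icc x₁ x₂, x < z → ∃ ξ ∈ Ioo x z,
        H z t - H x t = Hx ξ t * (z - x) := by
      intro t ht x hx z hz hxz
      have hsub : Icc x z ⊆ Icc x₁ x₂ := Icc_subset_Icc hx.1 hz.2
      obtain ⟨ξ, hξ, he⟩ := exists_hasDerivAt_eq_slope (fun x => H x t) (fun x => Hx x t) hxz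
        (fun y hy => (hd t ht y (hsub hy)).continuousAt.continuousWithinAt)
        (fun y hy => hd t ht y (hsub ⟨hy.1.le, hy.2.le⟩))
      exact ⟨ξ, hξ, by rw [he, div_mul_cancel₀ _ (sub_pos.2 hxz).ne']⟩
    intro t ht x hx z hz
    rcases lt_trichotomy x z with h | h | h
    · obtain ⟨ξ, hξ, he⟩ := key t ht x hx z hz h
      exact ⟨ξ, by rw [uIcc_of_le h.le]; exact ⟨hξ.1.le, hξ.2.le⟩, he⟩
    · exact ⟨x, left_mem_uIcc, by rw [h]; ring⟩
    · obtain ⟨ξ, hξ, he⟩ := key t ht z hz x hx h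
      exact ⟨ξ, by rw [uIcc_of_ge h.le]; exact ⟨hξ.1.le, hξ.2.le⟩, by linarith⟩
  have hlow : ∀ t ∈ Icc t₁ t₂, ∀ x ∈ Icc x₁ x₂, ∀ z ∈ Icc x₁ x₂, |z - x| ≤ |H z t - H x t| / c := by
    intro t ht x hx z hz
    obtain ⟨ξ, hξ, he⟩ := hmvt t ht x hx z hz
    have hξc := hc t ht ξ (uIcc_subset_Icc hx hz hξ)
    rw [he, abs_mul, abs_of_pos (hc0.trans_le hξc), le_div_iff₀ hc0, mul_comm]
    gcongr
  have hXI : ∀ y ∈ Icc ym yp, ∀ t ∈ Icc t₁ t₂, X y t ∈ Icc x₁ x₂ := fun y hy t ht =>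
    Ioo_subset_Icc_self (hX y t hy ht).1
  have hlip : ∀ y ∈ Icc ym yp, ∀ z ∈ Icc ym yp, ∀ t ∈ Icc t₁ t₂,
      |X y t - X z t| ≤ |y - z| / c := by
    intro y hy z hz t ht
    have := hlow t ht (X z t) (hXI z hz t ht) (X y t) (hXI y hy t ht)
    rwa [(hX y t hy ht).2, (hX z t hz ht).2] at this
  have hXt : ∀ y ∈ Icc ym yp, ContinuousOn (fun t => X y t) (Icc t₁ t₂) := by
    intro y hy t ht
    have hXc := hHt (X y t) (hXI y hy t ht) t ht
    have h3 : Tendsto (fun s => |H (X y t) s - H (X y t) t| / c) (𝓝[Icc t₁ t₂] t) (𝓝 0) := by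
      have := ((hXc.tendsto.sub_const (H (X y t) t)).abs).div_const c
      simpa using this
    refine tendsto_iff_dist_tendsto_zero.2 (squeeze_zero' (Eventually.of_forall fun _ => dist_nonneg)
      ?_ h3)
    filter_upwards [self_mem_nhdsWithin] with s hs
    have := hlow s hs (X y s) (hXI y hy s hs) (X y t) (hXI y hy t ht)
    rw [(hX y s hy hs).2] at this
    rwa [dist_comm, Real.dist_eq, (hX y t hy ht).2]
  refine ⟨X, fun y hy t ht => hX y t hy ht, hlip, hXt, ?_, ?_⟩
  · intro y hy t ht
    have hyI := Ioo_subset_Icc_self hy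
    refine HasDerivAt.of_local_left_inverse (f := fun x => H x t) ?_
      (hd t ht _ (hXI y hyI t ht)) (hc0.trans_le (hc t ht _ (hXI y hyI t ht))).ne' ?_
    · have h3 : Tendsto (fun z => |z - y| / c) (𝓝 y) (𝓝 0) := by
        have h4 : Continuous fun z => |z - y| / c := by fun_prop
        simpa using h4.tendsto y
      refine tendsto_iff_dist_tendsto_zero.2
        (squeeze_zero' (Eventually.of_forall fun _ => dist_nonneg) ?_ h3)
      filter_upwards [Ioo_mem_nhds hy.1 hy.2] with z hz
      exact hlip z (Ioo_subset_Icc_self hz) y hyI t ht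
    · filter_upwards [Ioo_mem_nhds hy.1 hy.2] with z hz
      exact (hX z t (Ioo_subset_Icc_self hz) ht).2
  · intro y hy t ht d hdt
    have htI := Ioo_subset_Icc_self ht
    set x := X y t with hxdef
    have hxI : x ∈ Icc x₁ x₂ := hXI y hy t htI
    have hexξ : ∀ s, ∃ ξ, s ∈ Icc t₁ t₂ → ξ ∈ uIcc x (X y s) ∧
        y - H x s = Hx ξ s * (X y s - x) := by
      intro s
      by_cases hs : s ∈ Icc t₁ t₂
      · obtain ⟨ξ, hξ, he⟩ := hmvt s hs x hxI (X y s) (hXI y hy s hs)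
        rw [(hX y s hy hs).2] at he
        exact ⟨ξ, fun _ => ⟨hξ, he⟩⟩
      · exact ⟨0, fun h => absurd h hs⟩
    choose ξ hξ using hexξ
    have hev : ∀ᶠ s in 𝓝 t, s ∈ Icc t₁ t₂ := Icc_mem_nhds ht.1 ht.2
    have hXs : Tendsto (fun s => X y s) (𝓝 t) (𝓝 x) :=
      ((hXt y hy).continuousAt hev).tendsto
    have hξlim : Tendsto ξ (𝓝 t) (𝓝 x) := by
      have h3 : Tendsto (fun s => |X y s - x|) (𝓝 t) (𝓝 0) := by
        simpa using (hXs.sub_const x).abs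
      refine tendsto_iff_dist_tendsto_zero.2
        (squeeze_zero' (Eventually.of_forall fun _ => dist_nonneg) ?_ h3)
      filter_upwards [hev] with s hs
      exact abs_sub_left_of_mem_uIcc (hξ s hs).1
    have hHξ : Tendsto (fun s => Hx (ξ s) s) (𝓝 t) (𝓝 (Hx x t)) := by
      have h3 : Tendsto (fun s => (ξ s, s)) (𝓝 t) (𝓝[Icc x₁ x₂ ×ˢ Icc t₁ t₂] (x, t)) := by
        refine tendsto_nhdsWithin_iff.2 ⟨hξlim.prodMk_nhds tendsto_id, ?_⟩
        filter_upwards [hev] with s hs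
        exact ⟨uIcc_subset_Icc hxI (hXI y hy s hs) (hξ s hs).1, hs⟩
      exact (hHx (x, t) ⟨hxI, htI⟩).tendsto.comp h3
    have hpos : Hx x t ≠ 0 := (hc0.trans_le (hc t htI x hxI)).ne'
    rw [hasDerivAt_iff_tendsto_slope] at hdt ⊢
    have h4 := (hdt.neg).div (hHξ.mono_left (nhdsWithin_le_nhds (s := {t}ᶜ))) hpos
    refine h4.congr' ?_
    filter_upwards [nhdsWithin_le_nhds hev] with s hs
    obtain ⟨hs1, hs2⟩ := hξ s hs
    have h5 : Hx (ξ s) s ≠ 0 :=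
      (hc0.trans_le (hc s hs _ (uIcc_subset_Icc hxI (hXI y hy s hs) hs1))).ne'
    have h6 : H x t = y := (hX y t hy htI).2
    simp only [Pi.div_apply, slope_def_field, h6]
    rw [← hxdef, eq_div_of_mul_eq h5 (by rw [mul_comm, ← hs2] : (X y s - x) * Hx (ξ s) s = _)]
    rw [← neg_div, neg_sub, div_right_comm]

open Set Topology in
/-- A continuous function on an interval is Lipschitz if it is Lipschitz along a set and has
bounded derivative off that set. -/
theorem abs_sub_le_of_lipschitz_on_of_hasDerivAt_off {φ φ' : ℝ → ℝ} {D : Set ℝ} {a b G : ℝ}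
    (hφ : ContinuousOn φ (Icc a b))
    (hD : ∀ y ∈ D ∩ Icc a b, ∀ z ∈ D ∩ Icc a b, |φ y - φ z| ≤ G * |y - z|)
    (hd : ∀ y ∈ Ioo a b, y ∉ D → HasDerivAt φ (φ' y) y)
    (hG : ∀ y ∈ Ioo a b, y ∉ D → |φ' y| ≤ G) {y z : ℝ} (hy : y ∈ Icc a b) (hz : z ∈ Icc a b) :
    |φ y - φ z| ≤ G * |y - z| := by
  wlog hyz : y ≤ z generalizing y z
  · rw [abs_sub_comm, abs_sub_comm y]
    exact this hz hy (le_of_not_ge hyz)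
  have hsubs : ∀ {p q}, y ≤ p → q ≤ z → Icc p q ⊆ Icc a b := fun h1 h2 =>
    Icc_subset_Icc (hy.1.trans h1) (h2.trans hz.2)
  have hgap : ∀ p q, y ≤ p → p ≤ q → q ≤ z → (∀ t ∈ Ioo p q, t ∉ D) →
      |φ p - φ q| ≤ G * (q - p) := by
    intro p q h1 h2 h3 h4
    rcases eq_or_lt_of_le h2 with h | h
    · simp [h]
    obtain ⟨ξ, hξ, he⟩ := exists_hasDerivAt_eq_slope φ φ' h (hφ.mono (hsubs h1 h3))
      (fun t ht => hd t ⟨by linarith [hy.1, ht.1], by linarith [hz.2, ht.2]⟩ (h4 t ht))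
    have h5 := hG ξ ⟨by linarith [hy.1, hξ.1], by linarith [hz.2, hξ.2]⟩ (h4 ξ hξ)
    rwa [he, abs_div, abs_of_pos (sub_pos.2 h), div_le_iff₀ (sub_pos.2 h), abs_sub_comm] at h5
  rw [abs_sub_comm y, abs_of_nonneg (sub_nonneg.2 hyz)]
  set S := D ∩ Icc y z with hS
  rcases S.eq_empty_or_nonempty with hemp | hne
  · exact hgap y z le_rfl hyz le_rfl fun t ht htD => by
      have : t ∈ S := ⟨htD, ht.1.le, ht.2.le⟩
      rw [hemp] at this; exact this
  · have hSb : BddBelow S := ⟨y, fun t ht => ht.2.1⟩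
    have hSa : BddAbove S := ⟨z, fun t ht => ht.2.2⟩
    have hSI : S ⊆ Icc a b := fun t ht => hsubs le_rfl le_rfl ht.2
    have hinf := csInf_mem_closure hne hSb
    have hsup := csSup_mem_closure hne hSa
    have hclI : closure S ⊆ Icc y z := closure_minimal (fun t ht => ht.2) isClosed_Icc
    have hcl : ∀ p ∈ closure S, ∀ q ∈ closure S, |φ p - φ q| ≤ G * |p - q| := by
      have hφS : ∀ p ∈ closure S, ContinuousWithinAt φ S p := fun p hp =>
        (hφ p (hsubs le_rfl le_rfl (hclI hp))).mono hSI
      intro p hp q hq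
      have e1 : ∀ s ∈ S, |φ p - φ s| ≤ G * |p - s| := by
        intro s hs
        have := mem_closure_iff_nhdsWithin_neBot.1 hp
        refine le_of_tendsto_of_tendsto (b := 𝓝[S] p) ((hφS p hp).sub_const (φ s)).abs
          (g := fun p => G * |p - s|) ?_ ?_
        · have : Continuous fun p => G * |p - s| := by fun_prop
          exact (this.tendsto p).mono_left nhdsWithin_le_nhds
        · filter_upwards [self_mem_nhdsWithin] with t ht
          exact hD t ⟨ht.1, hSI ht⟩ s ⟨hs.1, hSI hs⟩
      have := mem_closure_iff_nhdsWithin_neBot.1 hq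
      refine le_of_tendsto_of_tendsto (b := 𝓝[S] q) ((hφS q hq).const_sub (φ p)).abs
        (g := fun q => G * |p - q|) ?_ ?_
      · have : Continuous fun q => G * |p - q| := by fun_prop
        exact (this.tendsto q).mono_left nhdsWithin_le_nhds
      · filter_upwards [self_mem_nhdsWithin] with t ht using e1 t ht
    have hle : sInf S ≤ sSup S := csInf_le_csSup hne hSb hSa
    have h1 := hgap y (sInf S) le_rfl (hclI hinf).1 (hclI hinf).2 fun t ht htD =>
      not_lt_of_ge (csInf_le hSb ⟨htD, ht.1.le, ht.2.le.trans (hclI hinf).2⟩) ht.2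
    have h2 := hgap (sSup S) z (hclI hsup).1 (hclI hsup).2 le_rfl fun t ht htD =>
      not_lt_of_ge (le_csSup hSa ⟨htD, (hclI hsup).1.trans ht.1.le, ht.2.le⟩) ht.1
    have h3 := hcl _ hinf _ hsup
    rw [abs_sub_comm (sInf S), abs_of_nonneg (sub_nonneg.2 hle)] at h3
    calc |φ y - φ z| ≤ |φ y - φ (sInf S)| + |φ (sInf S) - φ (sSup S)| + |φ (sSup S) - φ z| := by
          refine (abs_sub_le _ (φ (sSup S)) _).trans ?_
          gcongr
          exact abs_sub_le _ _ _
      _ ≤ _ := by linarith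

open Set Topology in
/-- An integrated ordinary differential equation for `φ`, valid wherever `φ` is differentiable,
together with an algebraic relation at the remaining points, forces differentiability. -/
theorem differentiableAt_of_integrated_equation {φ P P' M : ℝ → ℝ} {a b r Δ K κ L : ℝ}
    (hΔ : 0 < Δ) (hκ : 0 < κ) (hφ : Continuous φ)
    (hP : ∀ y ∈ Icc a b, HasDerivAt P (P' y) y) (hPK : ∀ y ∈ Icc a b, |P' y| ≤ K)
    (hPκ : ∀ y ∈ Icc a b, κ ≤ P y)
    (hM : ∀ y ∈ Icc a b, ∀ z ∈ Icc a b, |M y - M z| ≤ L * |y - z|)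
    (hreg : ∀ y ∈ Icc a b, DifferentiableAt ℝ φ y →
      deriv φ y * P y + φ y * P' y = -M y - (φ y + r) * Δ)
    (hsing : ∀ y ∈ Icc a b, ¬DifferentiableAt ℝ φ y → M y = -(φ y + r) * Δ)
    {y₀ : ℝ} (hy₀ : y₀ ∈ Ioo a b) : DifferentiableAt ℝ φ y₀ := by
  have hab : a < b := hy₀.1.trans hy₀.2
  have haI : a ∈ Icc a b := ⟨le_rfl, hab.le⟩
  have hL : 0 ≤ L := by
    have := (abs_nonneg _).trans (hM a haI b ⟨hab.le, le_rfl⟩)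
    exact nonneg_of_mul_nonneg_left this (abs_pos.2 (sub_ne_zero.2 hab.ne))
  have hMc : ContinuousOn M (Icc a b) := by
    have : LipschitzOnWith L.toNNReal M (Icc a b) := LipschitzOnWith.of_dist_le_mul
      fun y hy z hz => by
        rw [Real.coe_toNNReal _ hL, Real.dist_eq, Real.dist_eq]; exact hM y hy z hz
    exact this.continuousOn
  obtain ⟨Cφ, hCφ⟩ := isCompact_Icc.exists_bound_of_continuousOn (s := Icc a b) hφ.continuousOn
  obtain ⟨CM, hCM⟩ := isCompact_Icc.exists_bound_of_continuousOn hMc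
  have hCφ0 : 0 ≤ Cφ := (norm_nonneg _).trans (hCφ a haI)
  have hK0 : 0 ≤ K := (abs_nonneg _).trans (hPK a haI)
  set G := max (L / Δ) ((CM + (Cφ + |r|) * Δ + Cφ * K) / κ) with hG
  have hφlip : ∀ y ∈ Icc a b, ∀ z ∈ Icc a b, |φ y - φ z| ≤ G * |y - z| := by
    intro y hy z hz
    refine abs_sub_le_of_lipschitz_on_of_hasDerivAt_off (φ' := deriv φ)
      (D := {y | ¬DifferentiableAt ℝ φ y}) hφ.continuousOn ?_ ?_ ?_ hy hz
    · rintro p ⟨hpD, hp⟩ q ⟨hqD, hq⟩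
      have h1 := hM p hp q hq
      rw [hsing p hp hpD, hsing q hq hqD] at h1
      have h2 : -(φ p + r) * Δ - -(φ q + r) * Δ = -((φ p - φ q) * Δ) := by ring
      rw [h2, abs_neg, abs_mul, abs_of_pos hΔ, ← le_div_iff₀ hΔ] at h1
      calc _ ≤ _ := h1
        _ = L / Δ * |p - q| := by ring
        _ ≤ G * |p - q| := by gcongr; exact le_max_left _ _
    · intro p _ hpD
      exact (not_not.1 hpD : DifferentiableAt ℝ φ p).hasDerivAt
    · intro p hp hpD
      have hpI := Ioo_subset_Icc_self hp
      have h1 := hreg p hpI (not_not.1 hpD)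
      refine le_trans ?_ (le_max_right _ _)
      rw [le_div_iff₀ hκ]
      have h2 : deriv φ p * P p = -M p - (φ p + r) * Δ - φ p * P' p := by linarith
      calc |deriv φ p| * κ ≤ |deriv φ p| * P p := by gcongr; exact hPκ p hpI
        _ = |-M p - (φ p + r) * Δ - φ p * P' p| := by
            rw [← h2, abs_mul, abs_of_pos (hκ.trans_le (hPκ p hpI))]
        _ ≤ |-M p| + |(φ p + r) * Δ| + |φ p * P' p| :=
            (abs_sub _ _).trans (by gcongr; exact abs_sub _ _)
        _ = |M p| + |φ p + r| * Δ + |φ p| * |P' p| := by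
            rw [abs_neg, abs_mul, abs_mul, abs_of_pos hΔ]
        _ ≤ CM + (Cφ + |r|) * Δ + Cφ * K := by
            have e1 : |M p| ≤ CM := hCM p hpI
            have e2 : |φ p| ≤ Cφ := hCφ p hpI
            have e3 := hPK p hpI
            gcongr
            exact (abs_add_le _ _).trans (by gcongr)
  have hG0 : 0 ≤ G := (div_nonneg hL hΔ.le).trans (le_max_left _ _)
  have hφAC : AbsolutelyContinuousOnInterval φ a b := by
    refine LipschitzOnWith.absolutelyContinuousOnInterval (K := G.toNNReal)
      (LipschitzOnWith.of_dist_le_mul ?_)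
    rw [uIcc_of_le hab.le]
    intro y hy z hz
    rw [Real.coe_toNNReal _ hG0, Real.dist_eq, Real.dist_eq]; exact hφlip y hy z hz
  have hPAC : AbsolutelyContinuousOnInterval P a b := by
    refine LipschitzOnWith.absolutelyContinuousOnInterval (K := K.toNNReal) ?_
    rw [uIcc_of_le hab.le]
    refine (convex_Icc a b).lipschitzOnWith_of_nnnorm_hasDerivWithin_le
      (fun y hy => (hP y hy).hasDerivWithinAt) fun y hy => ?_
    rw [← NNReal.coe_le_coe, Real.coe_toNNReal _ hK0]
    exact hPK y hy
  set ρ : ℝ → ℝ := fun y => -M y - (φ y + r) * Δ with hρ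
  have hρc : ContinuousOn ρ (Icc a b) := by
    have := hφ.continuousOn (s := Icc a b)
    exact hMc.neg.sub ((this.add continuousOn_const).mul continuousOn_const)
  have hΨAC := hφAC.mul hPAC
  have hae : ∀ᵐ y, y ∈ uIcc a b → deriv (φ * P) y = ρ y := by
    filter_upwards [hφAC.ae_differentiableAt] with y hy hyI
    have h1 := hy hyI
    rw [uIcc_of_le hab.le] at hyI
    rw [(h1.hasDerivAt.mul (hP y hyI)).deriv, hreg y hyI h1]
  have hint : ∀ y ∈ Icc a b, φ y * P y = φ a * P a + ∫ z in a..y, ρ z := by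
    intro y hy
    have hsub : uIcc a y ⊆ uIcc a b := by
      rw [uIcc_of_le hy.1, uIcc_of_le hab.le]; exact Icc_subset_Icc_right hy.2
    have h1 := (hΨAC.mono hsub).integral_deriv_eq_sub
    have h2 : ∫ z in a..y, deriv (φ * P) z = ∫ z in a..y, ρ z := by
      apply intervalIntegral.integral_congr_ae
      filter_upwards [hae] with z hz hzI using hz (hsub (uIoc_subset_uIcc hzI))
    rw [h2] at h1
    simp only [Pi.mul_apply] at h1
    linarith
  have hy₀I := Ioo_subset_Icc_self hy₀
  have hderiv : HasDerivAt (fun y => ∫ z in a..y, ρ z) (ρ y₀) y₀ := by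
    refine intervalIntegral.integral_hasDerivAt_right ?_ ?_ ?_
    · apply ContinuousOn.intervalIntegrable
      rw [uIcc_of_le hy₀I.1]
      exact hρc.mono (Icc_subset_Icc_right hy₀I.2)
    · exact (hρc.mono Ioo_subset_Icc_self).stronglyMeasurableAtFilter isOpen_Ioo y₀ hy₀
    · exact hρc.continuousAt (Icc_mem_nhds hy₀.1 hy₀.2)
  have hquot : DifferentiableAt ℝ (fun y => (φ a * P a + ∫ z in a..y, ρ z) / P y) y₀ :=
    ((differentiableAt_const _).add hderiv.differentiableAt).div (hP y₀ hy₀I).differentiableAt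
      (hκ.trans_le (hPκ y₀ hy₀I)).ne'
  refine hquot.congr_of_eventuallyEq ?_
  filter_upwards [Icc_mem_nhds hy₀.1 hy₀.2] with y hy
  rw [← hint y hy, mul_div_cancel_right₀ _ (hκ.trans_le (hPκ y hy)).ne']

open Set Topology Classical in
theorem aestronglyMeasurable_of_hasDerivAt {p p' : ℝ → ℝ → ℝ} {s : Set ℝ} {μ : Measure ℝ} {y : ℝ}
    (hs : MeasurableSet s)
    (hp : ∀ᶠ z in 𝓝 y, AEStronglyMeasurable (p z) (μ.restrict s))
    (hd : ∀ t ∈ s, HasDerivAt (fun z => p z t) (p' y t) y) :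
    AEStronglyMeasurable (p' y) (μ.restrict s) := by
  refine aestronglyMeasurable_of_tendsto_ae (𝓝[≠] y)
    (f := fun z t => if AEStronglyMeasurable (p z) (μ.restrict s) then slope (fun w => p w t) y z
      else 0) (fun z => ?_) ?_
  · by_cases h : AEStronglyMeasurable (p z) (μ.restrict s)
    · simp only [h, if_true, slope_def_field]
      have h1 := (h.sub hp.self_of_nhds).const_mul (z - y)⁻¹
      refine h1.congr (Eventually.of_forall fun t => ?_)
      simp only [Pi.sub_apply]
      rw [div_eq_inv_mul]
    · simp only [h, if_false]
      exact aestronglyMeasurable_const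
  · filter_upwards [ae_restrict_mem hs] with t ht
    refine (hasDerivAt_iff_tendsto_slope.1 (hd t ht)).congr' ?_
    filter_upwards [nhdsWithin_le_nhds hp] with z hz
    simp [hz]

namespace IsGammaSolution

open Set Topology

variable {β : ℝ → ℝ} {r T : ℝ} {H : ℝ → ℝ → ℝ}

set_option maxHeartbeats 1000000 in
theorem differentiableAt_deriv_of_strip (hs : IsGammaSolution β r T H) {x₁ x₂ t₁ t₂ c n y₀ : ℝ}
    (ht : t₁ < t₂) (hT : Icc t₁ t₂ ⊆ Ioo 0 T) (hx : x₁ < x₂) (hc0 : 0 < c)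
    (hHx : ContinuousOn (fun p : ℝ × ℝ => deriv (fun y => H y p.2) p.1)
      (Icc x₁ x₂ ×ˢ Icc t₁ t₂))
    (hc : ∀ t ∈ Icc t₁ t₂, ∀ x ∈ Icc x₁ x₂, c ≤ deriv (fun y => H y t) x)
    (hn : ∀ t ∈ Icc t₁ t₂, ∀ x ∈ Icc x₁ x₂, |deriv (deriv fun y => H y t) x| ≤ n)
    (h1 : ∀ t ∈ Icc t₁ t₂, H x₁ t < y₀) (h2 : ∀ t ∈ Icc t₁ t₂, y₀ < H x₂ t) :
    DifferentiableAt ℝ (deriv β) y₀ := by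
  have hHt : ∀ x, ContinuousOn (fun t => H x t) (Icc t₁ t₂) := fun x =>
    (hs.continuousOn_time x).mono hT
  have hne : (Icc t₁ t₂).Nonempty := ⟨t₁, le_rfl, ht.le⟩
  obtain ⟨ym, hym, hymH⟩ : ∃ ym < y₀, ∀ t ∈ Icc t₁ t₂, H x₁ t < ym := by
    obtain ⟨s, hs1, hs2⟩ := isCompact_Icc.exists_isMaxOn hne (hHt x₁)
    obtain ⟨ym, h3, h4⟩ := exists_between (h1 s hs1)
    exact ⟨ym, h4, fun t ht => (hs2 ht).trans_lt h3⟩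
  obtain ⟨yp, hyp, hypH⟩ : ∃ yp > y₀, ∀ t ∈ Icc t₁ t₂, yp < H x₂ t := by
    obtain ⟨s, hs1, hs2⟩ := isCompact_Icc.exists_isMinOn hne (hHt x₂)
    obtain ⟨yp, h3, h4⟩ := exists_between (h2 s hs1)
    exact ⟨yp, h3, fun t ht => h4.trans_le (hs2 ht)⟩
  obtain ⟨X, hX, hXlip, hXc, hXy, hXt⟩ := exists_level_curves (H := H)
    (Hx := fun x t => deriv (fun y => H y t) x) hx hc0
    (fun t ht x _ => hs.hasDerivAt_space (hT ht) x) hc (fun x _ => hHt x) hHx hymH hypH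
  set p : ℝ → ℝ → ℝ := fun y t => deriv (fun z => H z t) (X y t) with hp
  set p' : ℝ → ℝ → ℝ := fun y t => deriv (deriv fun z => H z t) (X y t) * (p y t)⁻¹ with hp'
  have hXI : ∀ y ∈ Icc ym yp, ∀ t ∈ Icc t₁ t₂, X y t ∈ Icc x₁ x₂ := fun y hy t ht =>
    Ioo_subset_Icc_self (hX y hy t ht).1
  have hpc : ∀ y ∈ Icc ym yp, ∀ t ∈ Icc t₁ t₂, c ≤ p y t := fun y hy t ht =>
    hc t ht _ (hXI y hy t ht)
  have hpcont : ∀ y ∈ Icc ym yp, ContinuousOn (p y) (Icc t₁ t₂) := fun y hy =>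
    hHx.comp (f := fun t => (X y t, t)) ((hXc y hy).prodMk continuousOn_id)
      fun t ht => ⟨hXI y hy t ht, ht⟩
  have hpd : ∀ y ∈ Ioo ym yp, ∀ t ∈ Icc t₁ t₂, HasDerivAt (fun z => p z t) (p' y t) y := by
    intro y hy t ht
    exact HasDerivAt.comp y (hs.differentiable_deriv_space (hT ht) (X y t)).hasDerivAt
      (hXy y hy t ht)
  have hp'n : ∀ y ∈ Icc ym yp, ∀ t ∈ Icc t₁ t₂, |p' y t| ≤ n / c := by
    intro y hy t ht
    have h3 := hpc y hy t ht
    have h4 := hn t ht _ (hXI y hy t ht)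
    have h5 : 0 ≤ n := (abs_nonneg _).trans h4
    rw [hp', abs_mul, abs_inv, abs_of_pos (hc0.trans_le h3), ← div_eq_mul_inv]
    gcongr
  have hIoc : uIoc t₁ t₂ ⊆ Icc t₁ t₂ := by rw [uIoc_of_le ht.le]; exact Ioc_subset_Icc_self
  have hpint : ∀ y ∈ Icc ym yp, IntervalIntegrable (p y) volume t₁ t₂ := fun y hy => by
    apply ContinuousOn.intervalIntegrable
    rw [uIcc_of_le ht.le]; exact hpcont y hy
  set Δ := t₂ - t₁ with hΔdef
  have hΔ : 0 < Δ := sub_pos.2 ht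
  set P : ℝ → ℝ := fun y => ∫ t in t₁..t₂, p y t with hP
  set P' : ℝ → ℝ := fun y => ∫ t in t₁..t₂, p' y t with hP'
  have hPd : ∀ y ∈ Ioo ym yp, IntervalIntegrable (p' y) volume t₁ t₂ ∧ HasDerivAt P (P' y) y := by
    intro y hy
    have hev : ∀ᶠ z in 𝓝 y, z ∈ Ioo ym yp := Ioo_mem_nhds hy.1 hy.2
    have hmeas : ∀ᶠ z in 𝓝 y, AEStronglyMeasurable (p z) (volume.restrict (uIoc t₁ t₂)) := by
      filter_upwards [hev] with z hz
      exact (hpint z (Ioo_subset_Icc_self hz)).def'.aestronglyMeasurable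
    exact intervalIntegral.hasDerivAt_integral_of_dominated_loc_of_deriv_le
      (bound := fun _ => n / c) hev hmeas (hpint y (Ioo_subset_Icc_self hy))
      (aestronglyMeasurable_of_hasDerivAt measurableSet_uIoc hmeas
        fun t ht => hpd y hy t (hIoc ht))
      (Eventually.of_forall fun t ht z hz => hp'n z (Ioo_subset_Icc_self hz) t (hIoc ht))
      intervalIntegrable_const
      (Eventually.of_forall fun t ht z hz => hpd z hz t (hIoc ht))
  have hsub : Icc ((ym + y₀) / 2) ((y₀ + yp) / 2) ⊆ Ioo ym yp := fun y hy =>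
    ⟨by linarith [hy.1], by linarith [hy.2]⟩
  have hint : ∀ y ∈ Ioo ym yp, ∀ V : ℝ → ℝ, IntervalIntegrable V volume t₁ t₂ →
      (∀ t ∈ Ioo t₁ t₂, -(deriv (fun s => H (X y t) s) t) / p y t = V t) →
      ∫ t in t₁..t₂, V t = X y t₂ - X y t₁ := by
    intro y hy V hV hVe
    have hyI := Ioo_subset_Icc_self hy
    refine intervalIntegral.integral_eq_sub_of_hasDerivAt_of_le ht.le (hXc y hyI) ?_ hV
    intro t ht'
    rw [← hVe t ht']
    exact hXt y hyI t ht' _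
      (hs.differentiableAt_time _ t (hT (Ioo_subset_Icc_self ht'))).hasDerivAt
  refine differentiableAt_of_integrated_equation (φ := deriv β) (P := P) (P' := P')
    (M := fun y => X y t₂ - X y t₁) (a := (ym + y₀) / 2) (b := (y₀ + yp) / 2) (r := r)
    (K := n / c * Δ) (κ := c * Δ) (L := 2 / c)
    hΔ (by positivity) hs.continuous_deriv_nonlinearity (fun y hy => (hPd y (hsub hy)).2)
    (fun y hy => ?_) (fun y hy => ?_) (fun y hy z hz => ?_) (fun y hy hreg => ?_)
    (fun y hy hsing => ?_) ⟨by linarith, by linarith⟩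
  · have h3 := intervalIntegral.norm_integral_le_of_norm_le_const (a := t₁) (b := t₂) (f := p' y)
      (C := n / c) fun t ht => hp'n y (Ioo_subset_Icc_self (hsub hy)) t (hIoc ht)
    rwa [abs_of_pos hΔ] at h3
  · have hyI := Ioo_subset_Icc_self (hsub hy)
    have h3 := intervalIntegral.integral_mono_on ht.le intervalIntegrable_const (hpint y hyI)
      fun t ht => hpc y hyI t ht
    rw [intervalIntegral.integral_const, smul_eq_mul, mul_comm] at h3
    exact h3
  · have hyI := Ioo_subset_Icc_self (hsub hy)
    have hzI := Ioo_subset_Icc_self (hsub hz)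
    have h3 := hXlip y hyI z hzI t₁ ⟨le_rfl, ht.le⟩
    have h4 := hXlip y hyI z hzI t₂ ⟨ht.le, le_rfl⟩
    calc |X y t₂ - X y t₁ - (X z t₂ - X z t₁)| = |(X y t₂ - X z t₂) - (X y t₁ - X z t₁)| := by
          congr 1; ring
      _ ≤ |y - z| / c + |y - z| / c := (abs_sub _ _).trans (add_le_add h4 h3)
      _ = 2 / c * |y - z| := by ring
  · have hyI := hsub hy
    have hpi := hpint y (Ioo_subset_Icc_self hyI)
    have hp'i := (hPd y hyI).1
    have h3 := hint y hyI
      (fun t => -(deriv (deriv β) y * p y t) - deriv β y * p' y t - (deriv β y + r))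
      (((hpi.const_mul _).neg.sub (hp'i.const_mul _)).sub intervalIntegrable_const) (by
        intro t ht'
        have htI := Ioo_subset_Icc_self ht'
        have hXe := (hX y (Ioo_subset_Icc_self hyI) t htI).2
        have h4 : p y t ≠ 0 := (hc0.trans_le (hpc y (Ioo_subset_Icc_self hyI) t htI)).ne'
        have h5 : HasDerivAt (fun x => deriv β (H x t) * deriv (fun z => H z t) x)
            (deriv (deriv β) y * p y t * p y t
              + deriv β y * deriv (deriv fun z => H z t) (X y t)) (X y t) := by
          have h6 : HasDerivAt (deriv β) (deriv (deriv β) y) (H (X y t) t) := by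
            rw [hXe]; exact hreg.hasDerivAt
          have h7 := (h6.comp (X y t) (hs.hasDerivAt_space (hT htI) (X y t))).mul
            (hs.differentiable_deriv_space (hT htI) (X y t)).hasDerivAt
          refine h7.congr_deriv ?_
          simp only [Function.comp_apply, hXe]
          rfl
        rw [hs.deriv_time_eq _ t (hT htI), hs.deriv_comp_space (hT htI), h5.deriv]
        simp only [hXe]
        change -(deriv (deriv β) y * p y t * p y t
              + deriv β y * deriv (deriv fun z => H z t) (X y t) + deriv β y * p y t
              + r * p y t) / p y t = _
        simp only [hp']
        field_simp
        ring)
    have i1 : IntervalIntegrable (fun t => -(deriv (deriv β) y * p y t)) volume t₁ t₂ :=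
      (hpi.const_mul _).neg
    have i2 : IntervalIntegrable (fun t => deriv β y * p' y t) volume t₁ t₂ := hp'i.const_mul _
    have i3 : IntervalIntegrable (fun t => -(deriv (deriv β) y * p y t) - deriv β y * p' y t)
      volume t₁ t₂ := i1.sub i2
    rw [intervalIntegral.integral_sub i3 intervalIntegrable_const,
      intervalIntegral.integral_sub i1 i2, intervalIntegral.integral_neg,
      intervalIntegral.integral_const_mul,
      intervalIntegral.integral_const_mul, intervalIntegral.integral_const, smul_eq_mul] at h3
    change deriv (deriv β) y * (∫ t in t₁..t₂, p y t) + deriv β y * (∫ t in t₁..t₂, p' y t) = _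
    rw [← h3]
    ring
  · have hyI := hsub hy
    have h3 := hint y hyI (fun t => -(deriv β y + r)) intervalIntegrable_const (by
        intro t ht'
        have htI := Ioo_subset_Icc_self ht'
        have hXe := (hX y (Ioo_subset_Icc_self hyI) t htI).2
        have h4 : p y t ≠ 0 := (hc0.trans_le (hpc y (Ioo_subset_Icc_self hyI) t htI)).ne'
        have h5 : ¬DifferentiableAt ℝ (deriv fun z => β (H z t)) (X y t) := by
          rw [hs.differentiableAt_flux_iff (hT htI) h4, hXe]; exact hsing
        rw [hs.deriv_time_eq _ t (hT htI), deriv_zero_of_not_differentiableAt h5,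
          hs.deriv_comp_space (hT htI)]
        simp only [hXe]
        change -(0 + deriv β y * p y t + r * p y t) / p y t = _
        field_simp
        ring)
    rw [intervalIntegral.integral_const, smul_eq_mul] at h3
    rw [← h3]
    ring

end IsGammaSolution

/-- The flux `∂_x β(H)` fails to be differentiable at a point where `β'(H) > 0`. -/
def IsSingularPoint (β : ℝ → ℝ) (H : ℝ → ℝ → ℝ) (x τ : ℝ) : Prop :=
  0 < deriv β (H x τ) ∧ ¬DifferentiableAt ℝ (deriv fun y => β (H y τ)) x

theorem IsSingularPoint.neg {β : ℝ → ℝ} {H : ℝ → ℝ → ℝ} {x τ : ℝ} (h : IsSingularPoint β H x τ) :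
    IsSingularPoint (fun y => -β (-y)) (fun x τ => -H x τ) x τ := by
  refine ⟨?_, fun hd => h.2 ?_⟩
  · have h1 : deriv (fun y => -β (-y)) (-H x τ) = deriv β (H x τ) := by
      rw [deriv.fun_neg, deriv_comp_neg]; simp
    rw [h1]; exact h.1
  · have h1 : (deriv fun y => - -β (H y τ)) = deriv fun y => β (H y τ) := by simp
    have h2 : (deriv fun y => -β (- -H y τ)) = fun y => -deriv (fun y => β (H y τ)) y := by
      ext y; simp
    rw [h2] at hd
    simpa using hd.neg

namespace IsGammaSolution

open Set Topology

variable {β : ℝ → ℝ} {r T : ℝ} {H : ℝ → ℝ → ℝ}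

theorem deriv_ne_zero_of_isSingularPoint (hs : IsGammaSolution β r T H) {x τ : ℝ}
    (hτ : τ ∈ Ioo 0 T) (h : IsSingularPoint β H x τ) : deriv (fun y => H y τ) x ≠ 0 :=
  fun h0 => h.2 (hs.differentiableAt_flux_of_deriv_eq_zero hτ h0)

theorem exists_isSingularPoint_of_gap (hs : IsGammaSolution β r T H)
    {xL x₁ xR τ₁ τ₂ κ c : ℝ} (hτ : τ₁ < τ₂) (hT : Icc τ₁ τ₂ ⊆ Ioo 0 T) (hL : xL < x₁)
    (hR : x₁ < xR) (hκ : 0 < κ) (hc : 0 < c)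
    (hφ : ∀ x ∈ Icc xL xR, ∀ τ ∈ Icc τ₁ τ₂, κ ≤ deriv β (H x τ))
    (hHx : ∀ x ∈ Icc xL xR, c ≤ deriv (fun y => H y τ₁) x)
    (hD : ¬DifferentiableAt ℝ (deriv β) (H x₁ τ₁)) :
    ∃ τ ∈ Ioo τ₁ τ₂, ∃ x ∈ Ioo xL xR, IsSingularPoint β H x τ := by
  by_contra! hcon
  have hτ₁ : τ₁ ∈ Icc τ₁ τ₂ := ⟨le_rfl, hτ.le⟩
  set K : Set (ℝ × ℝ) := Icc xL xR ×ˢ Icc τ₁ τ₂ with hK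
  have hHK : ContinuousOn (fun p : ℝ × ℝ => H p.1 p.2) K :=
    hs.continuousOn.mono (prod_mono (subset_univ _) hT)
  have hinj : InjOn β ((fun p : ℝ × ℝ => H p.1 p.2) '' K) := by
    refine (strictMonoOn_of_deriv_pos (OrdConnected.convex ?_)
      hs.contDiff_nonlinearity.continuous.continuousOn fun y hy => ?_).injOn
    · exact (((isPreconnected_Icc.prod isPreconnected_Icc).image _ hHK)).ordConnected
    · obtain ⟨p, hp, rfl⟩ := interior_subset hy
      exact hκ.trans_le (hφ _ hp.1 _ hp.2)
  have hslope : ∀ x ∈ Icc xL xR, ∀ y ∈ Icc xL xR, x ≤ y →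
      κ * c * (y - x) ≤ β (H y τ₁) - β (H x τ₁) := by
    intro x hx y hy hxy
    refine (convex_Icc xL xR).mul_sub_le_image_sub_of_le_deriv (f := fun y => β (H y τ₁))
      (hs.contDiff_nonlinearity.continuous.comp
        (hs.continuous_space (hT hτ₁))).continuousOn
      (fun z _ => (hs.hasDerivAt_comp_space (hT hτ₁) z).differentiableAt.differentiableWithinAt)
      (fun z hz => ?_) x hx y hy hxy
    rw [(hs.hasDerivAt_comp_space (hT hτ₁) z).deriv]
    have hz := interior_subset hz
    exact mul_le_mul (hφ z hz _ hτ₁) (hHx z hz) hc.le (hκ.le.trans (hφ z hz _ hτ₁))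
  obtain ⟨τ, hτm, x, hx, hu, hux⟩ := exists_level_crossing_of_parabolic
    (u := fun x τ => β (H x τ)) (ux := fun x τ => deriv (fun y => β (H y τ)) x)
    (uxx := fun x τ => deriv (deriv fun y => β (H y τ)) x) (a := fun x τ => deriv β (H x τ))
    (r := r) (κ := κ) (c := κ * c) (u₀ := β (H x₁ τ₁)) hτ hL hR hκ (mul_pos hκ hc)
    (hs.contDiff_nonlinearity.continuous.comp_continuousOn hHK)
    (fun x _ τ hτ' => (hs.hasDerivAt_comp_space
      (hT (Ioo_subset_Icc_self hτ')) x).differentiableAt.hasDerivAt)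
    (fun x hx τ hτ' => by
      have h1 : DifferentiableAt ℝ (deriv fun y => β (H y τ)) x := by
        by_contra h2
        exact hcon τ hτ' x hx ⟨hκ.trans_le (hφ _ (Ioo_subset_Icc_self hx) _
          (Ioo_subset_Icc_self hτ')), h2⟩
      exact h1.hasDerivAt)
    (fun x _ τ hτ' => by
      have hτ' := hT (Ioo_subset_Icc_self hτ')
      refine ((hs.hasDerivAt_nonlinearity (H x τ)).comp τ (hs.hasDerivAt_time hτ' x)).congr_deriv ?_
      rw [hs.deriv_comp_space hτ']
      ring)
    (fun x hx τ hτ' => hφ _ (Ioo_subset_Icc_self hx) _ (Ioo_subset_Icc_self hτ'))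
    (fun x hx => by
      linarith [hslope x₁ ⟨hL.le, hR.le⟩ x ⟨hL.le.trans hx.1, hx.2⟩ hx.1])
    (by
      have h1 := hslope xL ⟨le_rfl, (hL.trans hR).le⟩ x₁ ⟨hL.le, hR.le⟩ hL.le
      have h2 : 0 < κ * c * (x₁ - xL) := by have := sub_pos.2 hL; positivity
      linarith)
  have hxI := Ioo_subset_Icc_self hx
  have hτI := Ioo_subset_Icc_self hτm
  have heq : H x τ = H x₁ τ₁ := hinj ⟨(x, τ), ⟨hxI, hτI⟩, rfl⟩
    ⟨(x₁, τ₁), ⟨⟨hL.le, hR.le⟩, hτ₁⟩, rfl⟩ hu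
  have hne : deriv (fun y => H y τ) x ≠ 0 := by
    intro h0
    simp only [hs.deriv_comp_space (hT hτI), h0, mul_zero, lt_irrefl] at hux
  refine hcon τ hτm x hx ⟨hκ.trans_le (hφ _ hxI _ hτI), ?_⟩
  rw [hs.differentiableAt_flux_iff (hT hτI) hne, heq]
  exact hD

theorem not_isSingularPoint_of_deriv_pos (hs : IsGammaSolution β r T H) {B J : Set ℝ} {M n : ℝ}
    (hBT : B ⊆ Ioo 0 T) (hBc : closure B ∩ Ioo 0 T ⊆ B) (hJ : IsOpen J)
    (hn : ∀ τ ∈ J ∩ B, ∀ x ∈ Icc (-M) M, |deriv (deriv fun y => H y τ) x| ≤ n)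
    (hB : ∀ τ ∈ Ioo 0 T, ∀ x ∈ Ioo (-M) M, IsSingularPoint β H x τ → τ ∈ B)
    {x₀ τ₀ : ℝ} (hx₀ : x₀ ∈ Ioo (-M) M) (hτ₀ : τ₀ ∈ J ∩ B)
    (hpos : 0 < deriv (fun y => H y τ₀) x₀) : ¬IsSingularPoint β H x₀ τ₀ := by
  intro hsing
  have hτT := hBT hτ₀.2
  have hHx := hs.continuousOn_deriv_space_of_bounded (fun t ht => hBT ht.2) hn
  have hHc : ContinuousAt (fun p : ℝ × ℝ => H p.1 p.2) (x₀, τ₀) :=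
    hs.continuousOn.continuousAt (prod_mem_nhds univ_mem (Ioo_mem_nhds hτT.1 hτT.2))
  set c := deriv (fun y => H y τ₀) x₀ / 2 with hc
  set κ := deriv β (H x₀ τ₀) / 2 with hκ
  have hc0 : 0 < c := half_pos hpos
  have hκ0 : 0 < κ := half_pos hsing.1
  have hev1 : ∀ᶠ p : ℝ × ℝ in 𝓝 (x₀, τ₀), κ < deriv β (H p.1 p.2) :=
    (hs.continuous_deriv_nonlinearity.continuousAt.comp hHc).eventually_const_lt
      (half_lt_self hsing.1)
  have hev2 : ∀ᶠ p : ℝ × ℝ in 𝓝 (x₀, τ₀), p ∈ Ioo (-M) M ×ˢ (J ∩ B) →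
      c < deriv (fun y => H y p.2) p.1 :=
    eventually_nhdsWithin_iff.1
      ((hHx (x₀, τ₀) ⟨hx₀, hτ₀⟩).eventually_const_lt (half_lt_self hpos))
  have hev3 : ∀ᶠ p : ℝ × ℝ in 𝓝 (x₀, τ₀), p ∈ Ioo (-M) M ×ˢ (J ∩ Ioo 0 T) :=
    prod_mem_nhds (Ioo_mem_nhds hx₀.1 hx₀.2)
      (inter_mem (hJ.mem_nhds hτ₀.1) (Ioo_mem_nhds hτT.1 hτT.2))
  obtain ⟨δ, hδ, hbox⟩ := Metric.nhds_basis_closedBall.eventually_iff.1 (hev1.and (hev2.and hev3))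
  have hmem : ∀ x ∈ Icc (x₀ - δ) (x₀ + δ), ∀ τ ∈ Icc (τ₀ - δ) (τ₀ + δ),
      (x, τ) ∈ Metric.closedBall (x₀, τ₀) δ := by
    intro x hx τ hτ
    rw [← closedBall_prod_same, Real.closedBall_eq_Icc, Real.closedBall_eq_Icc]
    exact ⟨hx, hτ⟩
  have hcx : ∀ τ ∈ Icc (τ₀ - δ) (τ₀ + δ), τ ∈ B → ∀ x ∈ Icc (x₀ - δ) (x₀ + δ),
      c ≤ deriv (fun y => H y τ) x := by
    intro τ hτ hτB x hx
    obtain ⟨-, h2, h3⟩ := hbox (hmem x hx τ hτ)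
    exact (h2 ⟨h3.1, h3.2.1, hτB⟩).le
  have hself : τ₀ ∈ Icc (τ₀ - δ) (τ₀ + δ) := ⟨by linarith, by linarith⟩
  have hmono : StrictMonoOn (fun x => H x τ₀) (Icc (x₀ - δ) (x₀ + δ)) :=
    strictMonoOn_of_deriv_pos (convex_Icc _ _) (hs.continuous_space hτT).continuousOn
      fun x hx => hc0.trans_le (hcx τ₀ hself hτ₀.2 x (interior_subset hx))
  have hx₀I : x₀ ∈ Icc (x₀ - δ) (x₀ + δ) := ⟨by linarith, by linarith⟩
  have hct : ∀ x, ContinuousAt (fun t => H x t) τ₀ := fun x =>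
    (hs.differentiableAt_time x τ₀ hτT).continuousAt
  have hl := (hct (x₀ - δ)).eventually_lt_const
    (hmono ⟨le_rfl, by linarith⟩ hx₀I (by linarith : x₀ - δ < x₀))
  have hr := (hct (x₀ + δ)).eventually_const_lt
    (hmono hx₀I ⟨by linarith, le_rfl⟩ (by linarith : x₀ < x₀ + δ))
  obtain ⟨ε, hε, hεb⟩ := Metric.nhds_basis_closedBall.eventually_iff.1
    (hl.and (hr.and (Icc_mem_nhds (by linarith : τ₀ - δ < τ₀) (by linarith : τ₀ < τ₀ + δ))))
  have hεI : ∀ τ ∈ Icc τ₀ (τ₀ + ε), τ ∈ Metric.closedBall τ₀ ε := by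
    intro τ hτ
    rw [Real.closedBall_eq_Icc]
    exact ⟨by linarith [hτ.1], hτ.2⟩
  have hD : ¬DifferentiableAt ℝ (deriv β) (H x₀ τ₀) := by
    rw [← hs.differentiableAt_flux_iff hτT hpos.ne']
    exact hsing.2
  have hT' : ∀ τ ∈ Icc τ₀ (τ₀ + ε), τ ∈ J ∩ Ioo 0 T := fun τ hτ =>
    (hbox (hmem x₀ hx₀I τ (hεb (hεI τ hτ)).2.2)).2.2.2
  by_cases hsub : Icc τ₀ (τ₀ + ε) ⊆ B
  · refine hD (hs.differentiableAt_deriv_of_strip (x₁ := x₀ - δ) (x₂ := x₀ + δ) (t₁ := τ₀)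
      (t₂ := τ₀ + ε) (n := n) (by linarith) (fun τ hτ => (hT' τ hτ).2) (by linarith) hc0
      (hHx.mono ?_) (fun τ hτ => hcx τ (hεb (hεI τ hτ)).2.2 (hsub hτ)) (fun τ hτ x hx => ?_)
      (fun τ hτ => (hεb (hεI τ hτ)).1) (fun τ hτ => (hεb (hεI τ hτ)).2.1))
    · rintro ⟨x, τ⟩ ⟨hx, hτ⟩
      exact ⟨(hbox (hmem x hx τ (hεb (hεI τ hτ)).2.2)).2.2.1, (hT' τ hτ).1, hsub hτ⟩
    · exact hn τ ⟨(hT' τ hτ).1, hsub hτ⟩ x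
        (Ioo_subset_Icc_self (hbox (hmem x hx τ (hεb (hεI τ hτ)).2.2)).2.2.1)
  · obtain ⟨τ', hτ', hτ'B⟩ := not_subset.1 hsub
    have hIcc : Icc τ₀ τ' ⊆ Icc τ₀ (τ₀ + ε) := Icc_subset_Icc_right hτ'.2
    have hcl : IsClosed (B ∩ Icc τ₀ τ') := by
      refine isClosed_of_closure_subset fun t ht => ?_
      have h1 : t ∈ Icc τ₀ τ' := isClosed_Icc.closure_subset (closure_mono inter_subset_right ht)
      exact ⟨hBc ⟨closure_mono inter_subset_left ht, (hT' t (hIcc h1)).2⟩, h1⟩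
    have hbdd : BddAbove (B ∩ Icc τ₀ τ') := ⟨τ', fun t ht => ht.2.2⟩
    have hτ₁ := hcl.csSup_mem ⟨τ₀, hτ₀.2, le_rfl, hτ'.1⟩ hbdd
    set τ₁ := sSup (B ∩ Icc τ₀ τ') with hτ₁def
    have hlt : τ₁ < τ' := hτ₁.2.2.lt_of_ne fun h => hτ'B (h ▸ hτ₁.1)
    have hτ₁I := hIcc hτ₁.2
    obtain ⟨x₁, hx₁, hx₁H⟩ : H x₀ τ₀ ∈ (fun x => H x τ₁) '' Ioo (x₀ - δ) (x₀ + δ) :=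
      intermediate_value_Ioo (by linarith) (hs.continuous_space (hBT hτ₁.1)).continuousOn
        ⟨(hεb (hεI τ₁ hτ₁I)).1, (hεb (hεI τ₁ hτ₁I)).2.1⟩
    obtain ⟨τ, hτ, x, hx, hsx⟩ := hs.exists_isSingularPoint_of_gap (κ := κ) (c := c) hlt
      (fun t ht => (hT' t (hIcc ⟨hτ₁.2.1.trans ht.1, ht.2⟩)).2) hx₁.1 hx₁.2 hκ0 hc0
      (fun x hx t ht => (hbox (hmem x hx t
        (hεb (hεI t (hIcc ⟨hτ₁.2.1.trans ht.1, ht.2⟩))).2.2)).1.le)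
      (fun x hx => hcx τ₁ (hεb (hεI τ₁ hτ₁I)).2.2 hτ₁.1 x hx)
      (by simpa only [hx₁H] using hD)
    have hτI : τ ∈ Icc τ₀ τ' := ⟨hτ₁.2.1.trans hτ.1.le, hτ.2.le⟩
    have hτB := hB τ (hT' τ (hIcc hτI)).2 x
      (hbox (hmem x (Ioo_subset_Icc_self hx) τ (hεb (hεI τ (hIcc hτI))).2.2)).2.2.1 hsx
    exact absurd (le_csSup hbdd ⟨hτB, hτI⟩) (not_le.2 hτ.1)

theorem not_isSingularPoint (hs : IsGammaSolution β r T H) {x τ : ℝ} (hτ : τ ∈ Ioo 0 T) :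
    ¬IsSingularPoint β H x τ := by
  intro hsing
  set M := |x| + 1 with hM
  set A : Set ℝ := {t | t ∈ Ioo 0 T ∧ ∃ y ∈ Ioo (-M) M, IsSingularPoint β H y t} with hA
  have hxM : x ∈ Ioo (-M) M := abs_lt.1 (by linarith)
  have hτA : τ ∈ A := ⟨hτ, x, hxM, hsing⟩
  set B : Set ℝ := closure A ∩ Ioo 0 T with hBdef
  have hAB : A ⊆ B := fun t ht => ⟨subset_closure ht, ht.1⟩
  obtain ⟨n, J, hJ, ⟨t, htJ, htB⟩, hn⟩ := hs.exists_portion_bounded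
    (isClosed_closure.isGδ.inter isOpen_Ioo.isGδ) (inter_subset_right : B ⊆ Ioo 0 T)
    ⟨τ, hAB hτA⟩ M
  obtain ⟨τ₀, hτ₀J, hτ₀A⟩ := mem_closure_iff.1 htB.1 J hJ htJ
  obtain ⟨hτ₀, x₀, hx₀, hs₀⟩ := hτ₀A
  have hBc : closure B ∩ Ioo 0 T ⊆ B := fun s hs' =>
    ⟨isClosed_closure.closure_subset (closure_mono inter_subset_left hs'.1), hs'.2⟩
  have hτ₀B : τ₀ ∈ J ∩ B := ⟨hτ₀J, hAB ⟨hτ₀, x₀, hx₀, hs₀⟩⟩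
  rcases (hs.deriv_ne_zero_of_isSingularPoint hτ₀ hs₀).lt_or_gt with hneg | hpos
  · have hd : ∀ t, (deriv fun y => -H y t) = fun y => -deriv (fun z => H z t) y := fun t => by
      ext y; exact deriv.fun_neg
    refine hs.neg.not_isSingularPoint_of_deriv_pos (n := n) inter_subset_right hBc hJ
      (fun s hs' y hy => ?_) (fun s hs' y hy hsy => hAB ⟨hs', y, hy, ?_⟩) hx₀ hτ₀B ?_ hs₀.neg
    · rw [hd, deriv.fun_neg, abs_neg]
      exact hn s hs' y hy
    · simpa only [neg_neg] using hsy.neg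
    · rw [hd]
      exact neg_pos.2 hneg
  · exact hs.not_isSingularPoint_of_deriv_pos inter_subset_right hBc hJ hn
      (fun s hs' y hy hsy => hAB ⟨hs', y, hy, hsy⟩) hx₀ hτ₀B hpos hs₀

/-- The flux of a solution is differentiable wherever the equation is not degenerate. -/
theorem differentiableAt_flux (hs : IsGammaSolution β r T H) {x τ : ℝ} (hτ : τ ∈ Ioo 0 T)
    (hφ : deriv β (H x τ) ≠ 0) : DifferentiableAt ℝ (deriv fun y => β (H y τ)) x := by
  rcases hφ.lt_or_gt with hneg | hpos
  · have hτ' : T - τ ∈ Ioo 0 T := ⟨by linarith [hτ.2], by linarith [hτ.1]⟩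
    by_contra hd
    refine hs.reverse.not_isSingularPoint (x := x) hτ' ⟨?_, fun h => hd ?_⟩
    · simp only [deriv.fun_neg, sub_sub_cancel]
      exact neg_pos.2 hneg
    · have h2 : (deriv fun y => -β (H y (T - (T - τ)))) = fun y => -deriv (fun y => β (H y τ)) y := by
        ext y; rw [sub_sub_cancel]; exact deriv.fun_neg
      rw [h2] at h
      simpa using h.neg
  · by_contra hd
    exact hs.not_isSingularPoint hτ ⟨hpos, hd⟩

end IsGammaSolution

open Set Topology in
theorem countable_setOf_eq_zero_and_deriv_ne_zero (f : ℝ → ℝ) :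
    {x | f x = 0 ∧ deriv f x ≠ 0}.Countable := by
  have : DiscreteTopology {x | f x = 0 ∧ deriv f x ≠ 0} := by
    rw [discreteTopology_subtype_iff]
    intro x hx
    have h1 := (differentiableAt_of_deriv_ne_zero hx.2).hasDerivAt.eventually_ne
      (c := 0) hx.2
    rw [← disjoint_iff, disjoint_principal_right]
    filter_upwards [h1] with y hy h2 using hy h2.1
  exact (countable_of_Lindelof_of_discrete : Countable {x | f x = 0 ∧ deriv f x ≠ 0})

open Set in
theorem max_payoff_mul_eq_indicator {E S : ℝ} (hE : 0 < E) (hS : 0 < S) (g : ℝ → ℝ) :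
    (fun x => max (S - E * Real.exp x) 0 * g x)
      = (Iio (Real.log (S / E))).indicator fun x => (S - E * Real.exp x) * g x := by
  ext x
  have h1 : x < Real.log (S / E) ↔ 0 < S - E * Real.exp x := by
    rw [Real.lt_log_iff_exp_lt (by positivity), lt_div_iff₀ hE, sub_pos, mul_comm]
  by_cases hx : x < Real.log (S / E)
  · rw [indicator_of_mem (by exact hx), max_eq_left (h1.1 hx).le]
  · rw [indicator_of_notMem (by exact hx), max_eq_right (not_lt.1 (h1.not.1 hx)), zero_mul]

/-- The value of `∫ (S - E e^x)⁺ ∂_τ H dx` for a solution of the Gamma equation. -/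
noncomputable def payoffFlux (β : ℝ → ℝ) (r E : ℝ) (H : ℝ → ℝ → ℝ) (S τ : ℝ) : ℝ :=
  S * β (H (Real.log (S / E)) τ)
    + r * (E * ∫ x in Set.Iio (Real.log (S / E)), Real.exp x * H x τ)

namespace IsGammaSolution

open Set Topology

variable {β : ℝ → ℝ} {r T : ℝ} {H : ℝ → ℝ → ℝ}

theorem intervalIntegral_payoff_mul_deriv_time (hs : IsGammaSolution β r T H) {τ : ℝ}
    (hτ : τ ∈ Ioo 0 T) {E S A : ℝ} (hE : 0 < E) (hS : 0 < S) (hA : A ≤ Real.log (S / E))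
    (hint : IntervalIntegrable (fun x => (S - E * Real.exp x) * deriv (fun t => H x t) τ) volume A
      (Real.log (S / E))) :
    ∫ x in A..Real.log (S / E), (S - E * Real.exp x) * deriv (fun t => H x t) τ
      = -((S - E * Real.exp A) * deriv (fun y => β (H y τ)) A)
        + S * (β (H (Real.log (S / E)) τ) - β (H A τ))
        + r * (-((S - E * Real.exp A) * H A τ)
          + E * ∫ x in A..Real.log (S / E), Real.exp x * H x τ) := by
  set L := Real.log (S / E) with hL
  have hexpL : S - E * Real.exp L = 0 := by
    rw [hL, Real.exp_log (by positivity)]; field_simp; ring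
  set w := deriv fun y => β (H y τ) with hw
  have hwc : Continuous w := hs.continuous_deriv_comp_space hτ
  have hHc := hs.continuous_space hτ
  have hHxc := hs.continuous_deriv_space hτ
  have hkd : ∀ x, HasDerivAt (fun x => S - E * Real.exp x) (-(E * Real.exp x)) x := fun x => by
    simpa using ((Real.hasDerivAt_exp x).const_mul E).const_sub S
  have i1 : IntervalIntegrable (fun x => r * ((S - E * Real.exp x) * deriv (fun y => H y τ) x))
      volume A L := Continuous.intervalIntegrable (by fun_prop) _ _
  have i2 : IntervalIntegrable (fun x => S * w x) volume A L :=
    Continuous.intervalIntegrable (by fun_prop) _ _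
  have i3 : IntervalIntegrable (fun x => (S - E * Real.exp x) * deriv (fun t => H x t) τ
      - r * ((S - E * Real.exp x) * deriv (fun y => H y τ) x)) volume A L := hint.sub i1
  have hftc := integral_eq_sub_of_hasDerivAt_of_ne_zero
    (f := fun x => (S - E * Real.exp x) * w x)
    (f' := fun x => (S - E * Real.exp x) * deriv (fun t => H x t) τ
      - r * ((S - E * Real.exp x) * deriv (fun y => H y τ) x) - S * w x)
    (s := {x | w x = 0 ∧ deriv w x ≠ 0}) hA (by fun_prop)
    (fun x _ hx => by
      have hwx : w x ≠ 0 := right_ne_zero_of_mul hx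
      have hφ : deriv β (H x τ) ≠ 0 := by
        rw [hw, hs.deriv_comp_space hτ] at hwx
        exact left_ne_zero_of_mul hwx
      refine ((hkd x).mul (hs.differentiableAt_flux hτ hφ).hasDerivAt).congr_deriv ?_
      rw [hs.deriv_time_eq x τ hτ]
      ring)
    (countable_setOf_eq_zero_and_deriv_ne_zero w)
    (fun x hx hxs h0 => by
      have hk : S - E * Real.exp x ≠ 0 := by
        have : E * Real.exp x < E * Real.exp L :=
          mul_lt_mul_of_pos_left (Real.exp_lt_exp.2 hx.2) hE
        linarith
      have hwx : w x = 0 := (mul_eq_zero.1 h0).resolve_left hk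
      have hwx' : deriv w x = 0 := by
        by_contra h
        exact hxs ⟨hwx, h⟩
      simp only [hs.deriv_time_eq x τ hτ]
      change _ * (deriv w x + w x + _) - _ - _ = _
      rw [hwx', hwx]
      ring)
    (i3.sub i2)
  rw [intervalIntegral.integral_sub i3 i2, intervalIntegral.integral_sub hint i1,
    intervalIntegral.integral_const_mul, intervalIntegral.integral_const_mul,
    intervalIntegral.integral_eq_sub_of_hasDerivAt
      (fun x _ => (hs.hasDerivAt_comp_space hτ x).differentiableAt.hasDerivAt)
      (hwc.intervalIntegrable _ _),
    intervalIntegral.integral_mul_deriv_eq_deriv_mul (fun x _ => hkd x)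
      (fun x _ => hs.hasDerivAt_space hτ x) (Continuous.intervalIntegrable (by fun_prop) _ _)
      (hHxc.intervalIntegrable _ _)] at hftc
  have h1 : ∫ x in A..L, -(E * Real.exp x) * H x τ = -(E * ∫ x in A..L, Real.exp x * H x τ) := by
    rw [← intervalIntegral.integral_const_mul, ← intervalIntegral.integral_neg]
    congr 1; ext x; ring
  rw [h1, hexpL] at hftc
  linarith

theorem integral_payoff_mul_deriv_time (hs : IsGammaSolution β r T H) (hβ0 : β 0 = 0) {τ : ℝ}
    (hτ : τ ∈ Ioo 0 T) {E S : ℝ} (hE : 0 < E) (hS : 0 < S)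
    (hlim0 : Tendsto (fun x => H x τ) atBot (𝓝 0))
    (hlim1 : Tendsto (deriv fun y => H y τ) atBot (𝓝 0))
    (hexp : IntegrableOn (fun x => Real.exp x * H x τ) (Iio (Real.log (S / E))))
    (hint : Integrable fun x => max (S - E * Real.exp x) 0 * deriv (fun t => H x t) τ) :
    ∫ x, max (S - E * Real.exp x) 0 * deriv (fun t => H x t) τ = payoffFlux β r E H S τ := by
  rw [max_payoff_mul_eq_indicator hE hS, integrable_indicator_iff measurableSet_Iio] at hint
  rw [max_payoff_mul_eq_indicator hE hS, integral_indicator measurableSet_Iio, payoffFlux]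
  have hint' := (integrableOn_Iic_iff_integrableOn_Iio).2 hint
  have hexp' := (integrableOn_Iic_iff_integrableOn_Iio).2 hexp
  have hk : Tendsto (fun A => S - E * Real.exp A) atBot (𝓝 S) := by
    simpa using (Real.tendsto_exp_atBot.const_mul E).const_sub S
  have hw : Tendsto (deriv fun y => β (H y τ)) atBot (𝓝 0) := by
    rw [hs.deriv_comp_space hτ]
    simpa using ((hs.continuous_deriv_nonlinearity.tendsto 0).comp hlim0).mul hlim1
  have hβ : Tendsto (fun A => β (H A τ)) atBot (𝓝 0) := by
    have := (hs.contDiff_nonlinearity.continuous.tendsto 0).comp hlim0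
    rwa [hβ0] at this
  have h1 := intervalIntegral_tendsto_integral_Iic (Real.log (S / E)) hint' tendsto_id
  have h2 := intervalIntegral_tendsto_integral_Iic (Real.log (S / E)) hexp' tendsto_id
  have h3 := ((hk.mul hw).neg.add
    ((hβ.const_sub (β (H (Real.log (S / E)) τ))).const_mul S)).add
    (((hk.mul hlim0).neg.add (h2.const_mul E)).const_mul r)
  rw [← integral_Iic_eq_integral_Iio, ← integral_Iic_eq_integral_Iio]
  refine tendsto_nhds_unique h1 ?_
  simp only [mul_zero, neg_zero, zero_add, sub_zero] at h3
  refine h3.congr' ?_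
  filter_upwards [eventually_le_atBot (Real.log (S / E))] with A hA
  refine (hs.intervalIntegral_payoff_mul_deriv_time hτ hE hS hA ?_).symm
  exact (intervalIntegrable_iff_integrableOn_Ioc_of_le hA).2
    (hint'.mono_set fun x hx => hx.2)

end IsGammaSolution

open Set Topology in
theorem continuousAt_uncurry_of_lipschitz {f : ℝ → ℝ → ℝ} {K s₀ τ₀ : ℝ}
    (hL : ∀ᶠ p : ℝ × ℝ in 𝓝 (s₀, τ₀), |f p.1 p.2 - f s₀ p.2| ≤ K * |p.1 - s₀|)
    (hc : ContinuousAt (fun τ => f s₀ τ) τ₀) :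
    ContinuousAt (fun p : ℝ × ℝ => f p.1 p.2) (s₀, τ₀) := by
  have h1 : Tendsto (fun p : ℝ × ℝ => f p.1 p.2 - f s₀ p.2) (𝓝 (s₀, τ₀)) (𝓝 0) := by
    refine squeeze_zero_norm' hL ?_
    have : ContinuousAt (fun p : ℝ × ℝ => K * |p.1 - s₀|) (s₀, τ₀) := by fun_prop
    simpa [ContinuousAt] using this
  have h2 : Tendsto (fun p : ℝ × ℝ => f s₀ p.2) (𝓝 (s₀, τ₀)) (𝓝 (f s₀ τ₀)) :=
    hc.comp (f := fun p : ℝ × ℝ => p.2) (x := (s₀, τ₀)) continuousAt_snd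
  simpa [ContinuousAt] using h1.add h2

open Set Topology in
theorem continuousAt_uncurry_of_hasDerivAt_hasDerivAt {f f' f'' : ℝ → ℝ → ℝ} {K ρ s₀ τ₀ : ℝ}
    (hρ : 0 < ρ)
    (hf : ∀ s ∈ Metric.ball s₀ ρ, ∀ τ ∈ Metric.ball τ₀ ρ, HasDerivAt (fun s => f s τ) (f' s τ) s)
    (hf' : ∀ s ∈ Metric.ball s₀ ρ, ∀ τ ∈ Metric.ball τ₀ ρ,
      HasDerivAt (fun s => f' s τ) (f'' s τ) s)
    (hK : ∀ s ∈ Metric.ball s₀ ρ, ∀ τ ∈ Metric.ball τ₀ ρ, |f'' s τ| ≤ K)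
    (hc : ∀ s ∈ Metric.ball s₀ ρ, ContinuousAt (fun τ => f s τ) τ₀) :
    ContinuousAt (fun p : ℝ × ℝ => f p.1 p.2) (s₀, τ₀) ∧
      ContinuousAt (fun p : ℝ × ℝ => f' p.1 p.2) (s₀, τ₀) := by
  have hs₀ : s₀ ∈ Metric.ball s₀ ρ := Metric.mem_ball_self hρ
  have hτ₀ : τ₀ ∈ Metric.ball τ₀ ρ := Metric.mem_ball_self hρ
  have hK0 : 0 ≤ K := (abs_nonneg _).trans (hK s₀ hs₀ τ₀ hτ₀)
  have hconv : Convex ℝ (Metric.ball s₀ ρ) := convex_ball s₀ ρ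
  have hball : ∀ᶠ p : ℝ × ℝ in 𝓝 (s₀, τ₀), p ∈ Metric.ball s₀ ρ ×ˢ Metric.ball τ₀ ρ :=
    prod_mem_nhds (Metric.ball_mem_nhds _ hρ) (Metric.ball_mem_nhds _ hρ)
  have hL' : ∀ s ∈ Metric.ball s₀ ρ, ∀ τ ∈ Metric.ball τ₀ ρ,
      |f' s τ - f' s₀ τ| ≤ K * |s - s₀| := fun s hs τ hτ =>
    hconv.norm_image_sub_le_of_norm_hasDerivWithin_le
      (fun z hz => (hf' z hz τ hτ).hasDerivWithinAt) (fun z hz => hK z hz τ hτ) hs₀ hs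
  have hquot : ∀ s ∈ Metric.ball s₀ ρ, ∀ τ ∈ Metric.ball τ₀ ρ, s₀ < s →
      |(f s τ - f s₀ τ) / (s - s₀) - f' s₀ τ| ≤ K * (s - s₀) := by
    intro s hs τ hτ hlt
    have hsub : Icc s₀ s ⊆ Metric.ball s₀ ρ := hconv.ordConnected.out hs₀ hs
    obtain ⟨ξ, hξ, hξe⟩ := exists_hasDerivAt_eq_slope (fun s => f s τ) (fun s => f' s τ) hlt
      (fun z hz => (hf z (hsub hz) τ hτ).continuousAt.continuousWithinAt)
      (fun z hz => hf z (hsub (Ioo_subset_Icc_self hz)) τ hτ)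
    rw [← hξe]
    refine (hL' ξ (hsub (Ioo_subset_Icc_self hξ)) τ hτ).trans ?_
    rw [abs_of_pos (sub_pos.2 hξ.1)]
    gcongr
    exact hξ.2.le
  have hc' : ContinuousAt (fun τ => f' s₀ τ) τ₀ := by
    rw [Metric.continuousAt_iff']
    intro ε hε
    obtain ⟨d, hd0, hd⟩ : ∃ d > 0, d < min ρ (ε / (3 * (K + 1))) :=
      exists_between (lt_min hρ (by positivity))
    have hdρ : s₀ + d ∈ Metric.ball s₀ ρ := by
      simpa [Real.dist_eq, abs_of_pos hd0] using hd.trans_le (min_le_left _ _)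
    have hKd : K * d < ε / 3 := by
      have h1 := (lt_div_iff₀ (by positivity)).1 (hd.trans_le (min_le_right _ _))
      nlinarith
    have hg : ContinuousAt (fun τ => (f (s₀ + d) τ - f s₀ τ) / (s₀ + d - s₀)) τ₀ :=
      ((hc _ hdρ).sub (hc _ hs₀)).div_const _
    filter_upwards [Metric.continuousAt_iff'.1 hg (ε / 3) (by positivity),
      Metric.ball_mem_nhds τ₀ hρ] with τ h1 hτ
    have h2 := hquot _ hdρ τ hτ (by linarith)
    have h3 := hquot _ hdρ τ₀ hτ₀ (by linarith)
    rw [Real.dist_eq] at h1 ⊢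
    simp only [add_sub_cancel_left] at h1 h2 h3
    rw [abs_lt] at h1 ⊢
    rw [abs_le] at h2 h3
    constructor <;> linarith [h1.1, h1.2, h2.1, h2.2, h3.1, h3.2]
  have hcf' : ContinuousAt (fun p : ℝ × ℝ => f' p.1 p.2) (s₀, τ₀) :=
    continuousAt_uncurry_of_lipschitz (K := K) (hball.mono fun p hp => hL' _ hp.1 _ hp.2) hc'
  refine ⟨?_, hcf'⟩
  have hbd : ∀ᶠ p : ℝ × ℝ in 𝓝 (s₀, τ₀), |f' p.1 p.2| < |f' s₀ τ₀| + 1 :=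
    hcf'.abs.eventually_lt_const (lt_add_one _)
  obtain ⟨δ, hδ, hδb⟩ := Metric.nhds_basis_ball.eventually_iff.1 (hbd.and hball)
  refine continuousAt_uncurry_of_lipschitz (K := |f' s₀ τ₀| + 1) ?_ (hc _ hs₀)
  filter_upwards [Metric.ball_mem_nhds (s₀, τ₀) hδ] with p hp
  rw [← ball_prod_same] at hp hδb
  have hmem : ∀ z ∈ Metric.ball s₀ δ, (z, p.2) ∈ Metric.ball s₀ δ ×ˢ Metric.ball τ₀ δ :=
    fun z hz => ⟨hz, hp.2⟩
  exact (convex_ball s₀ δ).norm_image_sub_le_of_norm_hasDerivWithin_le (f := fun s => f s p.2)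
    (f' := fun s => f' s p.2)
    (fun z hz => (hf z (hδb (hmem z hz)).2.1 p.2 (hδb (hmem z hz)).2.2).hasDerivWithinAt)
    (fun z hz => (hδb (hmem z hz)).1.le) (Metric.mem_ball_self hδ) hp.1

/-- A family of option values `Q` with Delta `M` and rescaled Gamma `h`, whose time derivative `q`
vanishes wherever it differs from the Black–Scholes flux `I`. -/
structure IsPayoffFamily (β : ℝ → ℝ) (r T : ℝ) (Q M h q I G : ℝ → ℝ → ℝ) : Prop where
  continuous_nonlinearity : Continuous β
  continuousAt_gamma : ∀ S ∈ Set.Ioi (0 : ℝ), ∀ τ ∈ Set.Ioo 0 T,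
    ContinuousAt (fun p : ℝ × ℝ => h p.1 p.2) (S, τ)
  hasDerivAt_time : ∀ S ∈ Set.Ioi (0 : ℝ), ∀ τ ∈ Set.Ioo 0 T,
    HasDerivAt (fun t => Q S t) (q S τ) τ
  hasDerivAt_value : ∀ S ∈ Set.Ioi (0 : ℝ), ∀ τ ∈ Set.Ioo 0 T,
    HasDerivAt (fun s => Q s τ) (M S τ) S
  hasDerivAt_delta : ∀ S ∈ Set.Ioi (0 : ℝ), ∀ τ ∈ Set.Ioo 0 T,
    HasDerivAt (fun s => M s τ) (h S τ / S) S
  flux_eq : ∀ S ∈ Set.Ioi (0 : ℝ), ∀ τ ∈ Set.Ioo 0 T,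
    I S τ = S * β (h S τ) + r * (S * M S τ - Q S τ)
  hasDerivAt_flux : ∀ S ∈ Set.Ioi (0 : ℝ), ∀ τ ∈ Set.Ioo 0 T,
    HasDerivAt (fun s => I s τ) (G S τ) S
  continuousAt_deriv_flux : ∀ S ∈ Set.Ioi (0 : ℝ), ∀ τ ∈ Set.Ioo 0 T,
    ContinuousAt (fun s => G s τ) S
  tendsto_flux : ∀ τ ∈ Set.Ioo 0 T,
    Tendsto (fun s => I s τ) (nhdsWithin 0 (Set.Ioi 0)) (nhds 0)
  time_deriv_eq : ∀ S ∈ Set.Ioi (0 : ℝ), ∀ τ ∈ Set.Ioo 0 T, q S τ = 0 ∨ q S τ = I S τ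
  eventually_deriv_flux_eq : ∀ S ∈ Set.Ioi (0 : ℝ), ∀ τ ∈ Set.Ioo 0 T,
    (∀ᶠ s in nhds S, HasDerivAt (fun t => h s t) 0 τ) → ∀ᶠ s in nhds S, G s τ = G S τ
  time_deriv_eq_of_stationary : ∀ τ ∈ Set.Ioo 0 T,
    (∀ S ∈ Set.Ioi (0 : ℝ), HasDerivAt (fun t => h S t) 0 τ) →
      ∀ S ∈ Set.Ioi (0 : ℝ), q S τ = I S τ

namespace IsPayoffFamily

open Set Topology

variable {β : ℝ → ℝ} {r T : ℝ} {Q M h q I G : ℝ → ℝ → ℝ}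

theorem continuousAt_flux (hf : IsPayoffFamily β r T Q M h q I G) {S τ : ℝ} (hS : 0 < S)
    (hτ : τ ∈ Ioo 0 T) : ContinuousAt (fun p : ℝ × ℝ => I p.1 p.2) (S, τ) := by
  have hΩ : ∀ᶠ p : ℝ × ℝ in 𝓝 (S, τ), p ∈ Ioi (0 : ℝ) ×ˢ Ioo 0 T :=
    prod_mem_nhds (Ioi_mem_nhds hS) (Ioo_mem_nhds hτ.1 hτ.2)
  have hh := hf.continuousAt_gamma S hS τ hτ
  have hN : ContinuousAt (fun p : ℝ × ℝ => h p.1 p.2 / p.1) (S, τ) :=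
    hh.div continuousAt_fst hS.ne'
  obtain ⟨ρ, hρ, hρb⟩ := Metric.nhds_basis_ball.eventually_iff.1
    (hΩ.and (hN.abs.eventually_lt_const (lt_add_one |h S τ / S|)))
  rw [← ball_prod_same] at hρb
  obtain ⟨hQ, hM⟩ := continuousAt_uncurry_of_hasDerivAt_hasDerivAt (f := Q) (f' := M)
    (f'' := fun s t => h s t / s) (K := |h S τ / S| + 1) hρ
    (fun s hs t ht => hf.hasDerivAt_value s (hρb (x := (s, t)) ⟨hs, ht⟩).1.1 t
      (hρb (x := (s, t)) ⟨hs, ht⟩).1.2)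
    (fun s hs t ht => hf.hasDerivAt_delta s (hρb (x := (s, t)) ⟨hs, ht⟩).1.1 t
      (hρb (x := (s, t)) ⟨hs, ht⟩).1.2)
    (fun s hs t ht => (hρb (x := (s, t)) ⟨hs, ht⟩).2.le)
    (fun s hs => (hf.hasDerivAt_time s
      (hρb (x := (s, τ)) ⟨hs, Metric.mem_ball_self hρ⟩).1.1 τ hτ).continuousAt)
  have h1 : ContinuousAt (fun p : ℝ × ℝ => β (h p.1 p.2)) (S, τ) :=
    hf.continuous_nonlinearity.continuousAt.comp hh
  have h2 : ContinuousAt (fun p : ℝ × ℝ => p.1 * β (h p.1 p.2) + r * (p.1 * M p.1 p.2 - Q p.1 p.2))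
      (S, τ) :=
    (continuousAt_fst.mul h1).add (((continuousAt_fst.mul hM).sub hQ).const_mul r)
  refine h2.congr ?_
  filter_upwards [hΩ] with p hp
  exact (hf.flux_eq p.1 hp.1 p.2 hp.2).symm

end IsPayoffFamily

/-- The value `Q` does not react to the nonzero flux `I`. -/
def IsStationaryAt (q I : ℝ → ℝ → ℝ) (S τ : ℝ) : Prop := q S τ = 0 ∧ I S τ ≠ 0

namespace IsPayoffFamily

open Set Topology

variable {β : ℝ → ℝ} {r T : ℝ} {Q M h q I G : ℝ → ℝ → ℝ}

theorem time_deriv_eq_zero_or_eq_flux_on_ball (hf : IsPayoffFamily β r T Q M h q I G)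
    {s τ ρ i₀ : ℝ} (hs : 0 < s) (hi₀ : i₀ ≠ 0) (hT : Metric.ball τ ρ ⊆ Ioo 0 T)
    (hI : ∀ t ∈ Metric.ball τ ρ, |I s t - i₀| < |i₀| / 2) :
    (∀ t ∈ Metric.ball τ ρ, q s t = 0) ∨ ∀ t ∈ Metric.ball τ ρ, q s t = I s t := by
  by_contra! hcon
  obtain ⟨⟨ta, hta, ha⟩, tb, htb, hb⟩ := hcon
  have ha' := (hf.time_deriv_eq s hs ta (hT hta)).resolve_left ha
  have hb' := (hf.time_deriv_eq s hs tb (hT htb)).resolve_right hb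
  have himg : OrdConnected (q s '' Metric.ball τ ρ) :=
    (convex_ball τ ρ).ordConnected.image_hasDerivWithinAt
      fun t ht => (hf.hasDerivAt_time s hs t (hT ht)).hasDerivWithinAt
  have hIa := hI ta hta
  have hmem : i₀ / 4 ∈ uIcc (q s tb) (q s ta) := by
    rw [ha', hb', mem_uIcc]
    rw [abs_lt] at hIa
    rcases hi₀.lt_or_gt with hneg | hpos
    · rw [abs_of_neg hneg] at hIa
      right; constructor <;> linarith [hIa.2]
    · rw [abs_of_pos hpos] at hIa
      left; constructor <;> linarith [hIa.1]
  obtain ⟨t, ht, hte⟩ := himg.uIcc_subset ⟨tb, htb, rfl⟩ ⟨ta, hta, rfl⟩ hmem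
  rcases hf.time_deriv_eq s hs t (hT ht) with h0 | h0
  · exact hi₀ (by linarith)
  · have h1 := hI t ht
    rw [← h0, hte, show i₀ / 4 - i₀ = -(3 / 4 * i₀) by ring, abs_neg, abs_mul,
      abs_of_pos (by norm_num : (0 : ℝ) < 3 / 4)] at h1
    linarith [abs_pos.2 hi₀]

theorem eventually_stationary_or_eventually_eq_flux (hf : IsPayoffFamily β r T Q M h q I G)
    {S τ : ℝ} (hS : 0 < S) (hτ : τ ∈ Ioo 0 T) (hI : I S τ ≠ 0) :
    (∀ᶠ p : ℝ × ℝ in 𝓝 (S, τ), IsStationaryAt q I p.1 p.2) ∨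
      ∀ᶠ p : ℝ × ℝ in 𝓝 (S, τ), q p.1 p.2 = I p.1 p.2 ∧ I p.1 p.2 ≠ 0 := by
  set i₀ := I S τ with hi₀
  have hΩ : ∀ᶠ p : ℝ × ℝ in 𝓝 (S, τ), p ∈ Ioi (0 : ℝ) ×ˢ Ioo 0 T :=
    prod_mem_nhds (Ioi_mem_nhds hS) (Ioo_mem_nhds hτ.1 hτ.2)
  have hIc := Metric.continuousAt_iff'.1 (hf.continuousAt_flux hS hτ) (|i₀| / 2)
    (half_pos (abs_pos.2 hI))
  obtain ⟨ρ, hρ, hρb⟩ := Metric.nhds_basis_ball.eventually_iff.1 (hΩ.and hIc)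
  rw [← ball_prod_same] at hρb
  have hbox : ∀ s ∈ Metric.ball S ρ, ∀ t ∈ Metric.ball τ ρ,
      0 < s ∧ t ∈ Ioo 0 T ∧ |I s t - i₀| < |i₀| / 2 := fun s hs t ht =>
    ⟨(hρb (x := (s, t)) ⟨hs, ht⟩).1.1, (hρb (x := (s, t)) ⟨hs, ht⟩).1.2,
      (hρb (x := (s, t)) ⟨hs, ht⟩).2⟩
  have hτρ : τ ∈ Metric.ball τ ρ := Metric.mem_ball_self hρ
  have hSρ : S ∈ Metric.ball S ρ := Metric.mem_ball_self hρ
  have hlow : ∀ s ∈ Metric.ball S ρ, ∀ t ∈ Metric.ball τ ρ, |i₀| / 2 < |I s t| := by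
    intro s hs t ht
    have h1 := (hbox s hs t ht).2.2
    have h2 := abs_sub_abs_le_abs_sub i₀ (I s t)
    rw [abs_sub_comm] at h2
    linarith
  have hne : ∀ s ∈ Metric.ball S ρ, ∀ t ∈ Metric.ball τ ρ, I s t ≠ 0 := fun s hs t ht =>
    abs_pos.1 ((half_pos (abs_pos.2 hI)).trans (hlow s hs t ht))
  have htype : ∀ s ∈ Metric.ball S ρ,
      (∀ t ∈ Metric.ball τ ρ, q s t = 0) ∨ ∀ t ∈ Metric.ball τ ρ, q s t = I s t := fun s hs =>
    hf.time_deriv_eq_zero_or_eq_flux_on_ball (hbox s hs τ hτρ).1 hI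
      (fun t ht => (hbox s hs t ht).2.1) fun t ht => (hbox s hs t ht).2.2
  have hsub : Icc (τ - ρ / 2) (τ + ρ / 2) ⊆ Metric.ball τ ρ := by
    rw [Real.ball_eq_Ioo]
    exact Icc_subset_Ioo (by linarith) (by linarith)
  set D : ℝ → ℝ := fun s => Q s (τ + ρ / 2) - Q s (τ - ρ / 2) with hD
  have hDc : ContinuousAt D S :=
    ((hf.hasDerivAt_value S hS _ (hbox S hSρ _ (hsub ⟨by linarith, le_rfl⟩)).2.1).continuousAt).sub
      (hf.hasDerivAt_value S hS _ (hbox S hSρ _ (hsub ⟨le_rfl, by linarith⟩)).2.1).continuousAt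
  have hDξ : ∀ s ∈ Metric.ball S ρ, ∃ ξ ∈ Metric.ball τ ρ, D s = q s ξ * ρ := by
    intro s hs
    obtain ⟨ξ, hξ, hξe⟩ := exists_hasDerivAt_eq_slope (fun t => Q s t) (fun t => q s t)
      (by linarith : τ - ρ / 2 < τ + ρ / 2)
      (fun t ht => (hf.hasDerivAt_time s (hbox s hs t (hsub ht)).1 t
        (hbox s hs t (hsub ht)).2.1).continuousAt.continuousWithinAt)
      (fun t ht => hf.hasDerivAt_time s (hbox s hs t (hsub (Ioo_subset_Icc_self ht))).1 t
        (hbox s hs t (hsub (Ioo_subset_Icc_self ht))).2.1)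
    refine ⟨ξ, hsub (Ioo_subset_Icc_self hξ), ?_⟩
    rw [hξe, show τ + ρ / 2 - (τ - ρ / 2) = ρ by ring, div_mul_cancel₀ _ hρ.ne']
  have hD0 : ∀ s ∈ Metric.ball S ρ, (∀ t ∈ Metric.ball τ ρ, q s t = 0) → D s = 0 := by
    intro s hs h0
    obtain ⟨ξ, hξ, hξe⟩ := hDξ s hs
    rw [hξe, h0 ξ hξ, zero_mul]
  have hDI : ∀ s ∈ Metric.ball S ρ, (∀ t ∈ Metric.ball τ ρ, q s t = I s t) →
      |i₀| / 2 * ρ < |D s| := by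
    intro s hs h0
    obtain ⟨ξ, hξ, hξe⟩ := hDξ s hs
    rw [hξe, h0 ξ hξ, abs_mul, abs_of_pos hρ]
    gcongr
    exact hlow s hs ξ hξ
  have hev : ∀ {P : ℝ → Prop}, (∀ᶠ s in 𝓝 S, P s) →
      ∀ᶠ p : ℝ × ℝ in 𝓝 (S, τ), P p.1 ∧ p.1 ∈ Metric.ball S ρ ∧ p.2 ∈ Metric.ball τ ρ := fun hP =>
    ((continuousAt_fst (p := (S, τ))).eventually hP).and
      (prod_mem_nhds (Metric.ball_mem_nhds _ hρ) (Metric.ball_mem_nhds _ hρ))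
  have hpos : 0 < |i₀| / 2 * ρ := mul_pos (half_pos (abs_pos.2 hI)) hρ
  rcases htype S hSρ with h0 | h0
  · left
    have h1 : |D S| < |i₀| / 2 * ρ := by rwa [hD0 S hSρ h0, abs_zero]
    filter_upwards [hev (hDc.abs.eventually_lt_const h1)] with p hp
    refine ⟨(htype p.1 hp.2.1).resolve_right (fun h2 => ?_) p.2 hp.2.2, hne _ hp.2.1 _ hp.2.2⟩
    exact lt_asymm hp.1 (hDI p.1 hp.2.1 h2)
  · right
    have h1 : D S ≠ 0 := abs_pos.1 (hpos.trans (hDI S hSρ h0))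
    filter_upwards [hev (hDc.eventually_ne h1)] with p hp
    exact ⟨(htype p.1 hp.2.1).resolve_left (fun h2 => hp.1 (hD0 p.1 hp.2.1 h2)) p.2 hp.2.2,
      hne _ hp.2.1 _ hp.2.2⟩

theorem eventually_isStationaryAt (hf : IsPayoffFamily β r T Q M h q I G) {S τ : ℝ} (hS : 0 < S)
    (hτ : τ ∈ Ioo 0 T) (hst : IsStationaryAt q I S τ) :
    ∀ᶠ p : ℝ × ℝ in 𝓝 (S, τ), IsStationaryAt q I p.1 p.2 := by
  refine (hf.eventually_stationary_or_eventually_eq_flux hS hτ hst.2).resolve_right fun h0 => ?_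
  obtain ⟨h1, h2⟩ := h0.self_of_nhds
  exact h2 (h1.symm.trans hst.1)

theorem isStationaryAt_of_frequently (hf : IsPayoffFamily β r T Q M h q I G) {S τ : ℝ} (hS : 0 < S)
    (hτ : τ ∈ Ioo 0 T) (hI : I S τ ≠ 0)
    (hfr : ∃ᶠ p : ℝ × ℝ in 𝓝 (S, τ), IsStationaryAt q I p.1 p.2) : IsStationaryAt q I S τ := by
  rcases hf.eventually_stationary_or_eventually_eq_flux hS hτ hI with h0 | h0
  · exact h0.self_of_nhds
  · obtain ⟨p, hp, hpq, hpI⟩ := (hfr.and_eventually h0).exists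
    exact absurd (hpq.symm.trans hp.1) hpI

theorem eventually_flux_eq_of_isStationaryAt (hf : IsPayoffFamily β r T Q M h q I G) {S τ : ℝ}
    (hS : 0 < S) (hτ : τ ∈ Ioo 0 T) (hst : IsStationaryAt q I S τ) :
    ∀ᶠ p : ℝ × ℝ in 𝓝 (S, τ), h p.1 p.2 = h p.1 τ ∧ I p.1 p.2 = I p.1 τ := by
  have hΩ : ∀ᶠ p : ℝ × ℝ in 𝓝 (S, τ), p ∈ Ioi (0 : ℝ) ×ˢ Ioo 0 T :=
    prod_mem_nhds (Ioi_mem_nhds hS) (Ioo_mem_nhds hτ.1 hτ.2)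
  obtain ⟨ρ, hρ, hρb⟩ := Metric.nhds_basis_ball.eventually_iff.1
    (hΩ.and (hf.eventually_isStationaryAt hS hτ hst))
  rw [← ball_prod_same] at hρb
  have hbox : ∀ s ∈ Metric.ball S ρ, ∀ t ∈ Metric.ball τ ρ,
      0 < s ∧ t ∈ Ioo 0 T ∧ q s t = 0 := fun s hs t ht =>
    ⟨(hρb (x := (s, t)) ⟨hs, ht⟩).1.1, (hρb (x := (s, t)) ⟨hs, ht⟩).1.2,
      (hρb (x := (s, t)) ⟨hs, ht⟩).2.1⟩
  have hτρ : τ ∈ Metric.ball τ ρ := Metric.mem_ball_self hρ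
  have hQ : ∀ s ∈ Metric.ball S ρ, ∀ t ∈ Metric.ball τ ρ, Q s t = Q s τ := by
    intro s hs t ht
    have h1 := (convex_ball τ ρ).norm_image_sub_le_of_norm_hasDerivWithin_le (C := 0)
      (fun u hu => (hf.hasDerivAt_time s (hbox s hs u hu).1 u
        (hbox s hs u hu).2.1).hasDerivWithinAt)
      (fun u hu => by rw [(hbox s hs u hu).2.2, norm_zero]) hτρ ht
    rw [zero_mul, norm_le_zero_iff, sub_eq_zero] at h1
    exact h1
  have hM : ∀ s ∈ Metric.ball S ρ, ∀ t ∈ Metric.ball τ ρ, M s t = M s τ := by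
    intro s hs t ht
    refine (hf.hasDerivAt_value s (hbox s hs t ht).1 t (hbox s hs t ht).2.1).unique
      ((hf.hasDerivAt_value s (hbox s hs t ht).1 τ hτ).congr_of_eventuallyEq ?_)
    filter_upwards [Metric.isOpen_ball.mem_nhds hs] with z hz using hQ z hz t ht
  have hh : ∀ s ∈ Metric.ball S ρ, ∀ t ∈ Metric.ball τ ρ, h s t = h s τ := by
    intro s hs t ht
    have h1 := (hf.hasDerivAt_delta s (hbox s hs t ht).1 t (hbox s hs t ht).2.1).unique
      ((hf.hasDerivAt_delta s (hbox s hs t ht).1 τ hτ).congr_of_eventuallyEq (by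
        filter_upwards [Metric.isOpen_ball.mem_nhds hs] with z hz using hM z hz t ht))
    have h2 := (hbox s hs t ht).1.ne'
    field_simp at h1
    exact h1
  filter_upwards [prod_mem_nhds (Metric.ball_mem_nhds S hρ) (Metric.ball_mem_nhds τ hρ)] with p hp
  have hpb := hbox p.1 hp.1 p.2 hp.2
  refine ⟨hh _ hp.1 _ hp.2, ?_⟩
  rw [hf.flux_eq p.1 hpb.1 p.2 hpb.2.1, hf.flux_eq p.1 hpb.1 τ hτ, hh _ hp.1 _ hp.2,
    hM _ hp.1 _ hp.2, hQ _ hp.1 _ hp.2]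

theorem hasDerivAt_gamma_of_isStationaryAt (hf : IsPayoffFamily β r T Q M h q I G) {S τ : ℝ}
    (hS : 0 < S) (hτ : τ ∈ Ioo 0 T) (hst : IsStationaryAt q I S τ) :
    HasDerivAt (fun t => h S t) 0 τ := by
  refine (hasDerivAt_const τ (h S τ)).congr_of_eventuallyEq ?_
  have h1 : ContinuousAt (fun t : ℝ => (S, t)) τ := by fun_prop
  filter_upwards [h1.eventually (hf.eventually_flux_eq_of_isStationaryAt hS hτ hst)] with t ht
    using ht.1

theorem isStationaryAt_of_isStationaryAt (hf : IsPayoffFamily β r T Q M h q I G) {S τ₀ : ℝ}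
    (hS : 0 < S) (hτ₀ : τ₀ ∈ Ioo 0 T) (hst : IsStationaryAt q I S τ₀) :
    ∀ τ ∈ Ioo 0 T, IsStationaryAt q I S τ ∧ I S τ = I S τ₀ := by
  have hcont : ∀ t : ℝ, ContinuousAt (fun t : ℝ => (S, t)) t := fun t => by fun_prop
  have hsub : Ioo 0 T ⊆ {t | t ∈ Ioo 0 T ∧ IsStationaryAt q I S t ∧ I S t = I S τ₀} := by
    refine isPreconnected_Ioo.subset_of_closure_inter_subset ?_ ⟨τ₀, hτ₀, hτ₀, hst, rfl⟩ ?_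
    · rw [isOpen_iff_mem_nhds]
      rintro t ⟨ht, hst, hI⟩
      filter_upwards [Ioo_mem_nhds ht.1 ht.2,
        (hcont t).eventually (hf.eventually_isStationaryAt hS ht hst),
        (hcont t).eventually (hf.eventually_flux_eq_of_isStationaryAt hS ht hst)] with u h1 h2 h3
      exact ⟨h1, h2, h3.2.trans hI⟩
    · rintro t ⟨htc, ht⟩
      have hfr := mem_closure_iff_frequently.1 htc
      have hI : I S t = I S τ₀ := by
        have hc : ContinuousAt (fun u => I S u) t :=
          ContinuousAt.comp (g := fun p : ℝ × ℝ => I p.1 p.2) (f := fun u => (S, u))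
            (hf.continuousAt_flux hS ht) (hcont t)
        by_contra hne
        obtain ⟨u, hu, hu'⟩ := (hfr.and_eventually (hc.eventually_ne hne)).exists
        exact hu' hu.2.2
      refine ⟨ht, hf.isStationaryAt_of_frequently hS ht (hI ▸ hst.2) ?_, hI⟩
      exact (hcont t).tendsto.frequently (hfr.mono fun u hu => hu.2.1)
  exact fun τ hτ => (hsub hτ).2

end IsPayoffFamily

namespace IsPayoffFamily

open Set Topology

variable {β : ℝ → ℝ} {r T : ℝ} {Q M h q I G : ℝ → ℝ → ℝ}

theorem eventually_flux_affine (hf : IsPayoffFamily β r T Q M h q I G) {S τ : ℝ} (hS : 0 < S)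
    (hτ : τ ∈ Ioo 0 T) (hst : IsStationaryAt q I S τ) :
    ∀ᶠ s in 𝓝 S, IsStationaryAt q I s τ ∧ G s τ = G S τ ∧
      I s τ = I S τ + G S τ * (s - S) := by
  have h1 : ContinuousAt (fun s : ℝ => (s, τ)) S := by fun_prop
  have h2 : ∀ᶠ s in 𝓝 S, 0 < s ∧ IsStationaryAt q I s τ :=
    (eventually_gt_nhds hS).and (h1.eventually (hf.eventually_isStationaryAt hS hτ hst))
  have h3 := hf.eventually_deriv_flux_eq S hS τ hτ
    (h2.mono fun s hs => hf.hasDerivAt_gamma_of_isStationaryAt hs.1 hτ hs.2)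
  obtain ⟨ρ, hρ, hρb⟩ := Metric.nhds_basis_ball.eventually_iff.1 (h2.and h3)
  filter_upwards [Metric.ball_mem_nhds S hρ] with s hs
  refine ⟨(hρb hs).1.2, (hρb hs).2, ?_⟩
  have h4 := (convex_ball S ρ).norm_image_sub_le_of_norm_hasDerivWithin_le (C := 0)
    (f := fun s => I s τ - G S τ * s) (f' := fun s => G s τ - G S τ * 1)
    (fun u hu => ((hf.hasDerivAt_flux u (hρb hu).1.1 τ hτ).sub
      ((hasDerivAt_id u).const_mul _)).hasDerivWithinAt)
    (fun u hu => by rw [(hρb hu).2, mul_one, sub_self, norm_zero]) (Metric.mem_ball_self hρ) hs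
  rw [zero_mul, norm_le_zero_iff] at h4
  linarith

theorem flux_affine_of_ne_zero (hf : IsPayoffFamily β r T Q M h q I G) {S s τ : ℝ} (hS : 0 < S)
    (hs : 0 < s) (hτ : τ ∈ Ioo 0 T) (hst : IsStationaryAt q I S τ)
    (hne : ∀ z ∈ uIcc S s, I S τ + G S τ * (z - S) ≠ 0) :
    IsStationaryAt q I s τ ∧ G s τ = G S τ ∧ I s τ = I S τ + G S τ * (s - S) := by
  have hpos : ∀ z ∈ uIcc S s, 0 < z := fun z hz => (lt_min hS hs).trans_le hz.1
  have hsub : uIcc S s ⊆ {z | 0 < z ∧ IsStationaryAt q I z τ ∧ G z τ = G S τ ∧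
      I z τ = I S τ + G S τ * (z - S)} := by
    refine isPreconnected_uIcc.subset_of_closure_inter_subset ?_
      ⟨S, left_mem_uIcc, hS, hst, rfl, by ring⟩ ?_
    · rw [isOpen_iff_mem_nhds]
      rintro z ⟨hz, hzst, hzG, hzI⟩
      filter_upwards [eventually_gt_nhds hz, hf.eventually_flux_affine hz hτ hzst] with u hu hu'
      refine ⟨hu, hu'.1, hu'.2.1.trans hzG, ?_⟩
      rw [hu'.2.2, hzI, hzG]
      ring
    · rintro z ⟨hzc, hzu⟩
      have hz := hpos z hzu
      have hfr := mem_closure_iff_frequently.1 hzc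
      have hIz : I z τ = I S τ + G S τ * (z - S) := by
        by_contra hcon
        have hc : ContinuousAt (fun u => I u τ - (I S τ + G S τ * (u - S))) z :=
          (hf.hasDerivAt_flux z hz τ hτ).continuousAt.sub (by fun_prop)
        obtain ⟨u, hu, hu'⟩ := (hfr.and_eventually (hc.eventually_ne (sub_ne_zero.2 hcon))).exists
        exact hu' (sub_eq_zero.2 hu.2.2.2)
      have hGz : G z τ = G S τ := by
        by_contra hcon
        obtain ⟨u, hu, hu'⟩ := (hfr.and_eventually
          ((hf.continuousAt_deriv_flux z hz τ hτ).eventually_ne hcon)).exists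
        exact hu' hu.2.2.1
      have h1 : ContinuousAt (fun u : ℝ => (u, τ)) z := by fun_prop
      exact ⟨hz, hf.isStationaryAt_of_frequently hz hτ (hIz ▸ hne z hzu)
        (h1.tendsto.frequently (hfr.mono fun u hu => hu.2.1)), hGz, hIz⟩
  exact (hsub right_mem_uIcc).2

theorem exists_flux_eq_mul_sub (hf : IsPayoffFamily β r T Q M h q I G) {S τ : ℝ} (hS : 0 < S)
    (hτ : τ ∈ Ioo 0 T) (hst : IsStationaryAt q I S τ) :
    ∃ κ S₁, κ ≠ 0 ∧ 0 < S₁ ∧ S₁ < S ∧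
      ∀ s, S₁ < s → IsStationaryAt q I s τ ∧ I s τ = κ * (s - S₁) := by
  set κ := G S τ with hκ
  set i₀ := I S τ with hi₀
  have hi : i₀ ≠ 0 := hst.2
  have hline : ∀ s, 0 < s → (∀ z ∈ uIcc S s, i₀ + κ * (z - S) ≠ 0) →
      IsStationaryAt q I s τ ∧ I s τ = i₀ + κ * (s - S) := fun s hs hne =>
    ⟨(hf.flux_affine_of_ne_zero hS hs hτ hst hne).1,
      (hf.flux_affine_of_ne_zero hS hs hτ hst hne).2.2⟩
  have hzero : (∀ z ∈ Ioc 0 S, i₀ + κ * (z - S) ≠ 0) → i₀ = κ * S := by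
    intro hne
    have h1 : Tendsto (fun s => i₀ + κ * (s - S)) (𝓝[>] 0) (𝓝 (i₀ + κ * (0 - S))) :=
      Continuous.tendsto' (by fun_prop) 0 _ rfl |>.mono_left nhdsWithin_le_nhds
    have h2 := tendsto_nhds_unique (hf.tendsto_flux τ hτ) (h1.congr' (by
      filter_upwards [Ioc_mem_nhdsGT hS] with s hs
      refine (hline s hs.1 fun z hz => hne z ?_).2.symm
      rw [uIcc_of_ge hs.2] at hz
      exact ⟨hs.1.trans_le hz.1, hz.2⟩))
    linarith
  have hκ0 : κ ≠ 0 := by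
    intro h0
    apply hi
    rw [hzero (fun z _ => by rw [h0]; simpa using hi), h0, zero_mul]
  set S₁ := S - i₀ / κ with hS₁
  have hroot : ∀ z, i₀ + κ * (z - S) = κ * (z - S₁) := fun z => by
    rw [hS₁]; field_simp; ring
  have hS₁S : S₁ ≠ S := fun h0 => by
    have := hroot S
    rw [h0, sub_self, mul_zero] at this
    exact hi (by linarith)
  have hzero' : (∀ z ∈ Ioc 0 S, z ≠ S₁) → S₁ = 0 := by
    intro hne
    have h1 := hzero fun z hz => by
      rw [hroot]; exact mul_ne_zero hκ0 (sub_ne_zero.2 (hne z hz))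
    rw [hS₁, h1, mul_div_cancel_left₀ _ hκ0, sub_self]
  have hlt : S₁ < S := by
    by_contra hge
    have h1 := hzero' fun z hz h2 => hS₁S (le_antisymm (h2 ▸ hz.2) (not_lt.1 hge))
    exact hge (h1 ▸ hS)
  have hnonneg : 0 ≤ S₁ := by
    by_contra hneg
    exact hneg (hzero' fun z hz h2 => hneg (h2 ▸ hz.1.le)).ge
  have hall : ∀ s, S₁ < s → IsStationaryAt q I s τ ∧ I s τ = κ * (s - S₁) := by
    intro s hs
    rw [← hroot]
    refine hline s (hnonneg.trans_lt hs) fun z hz => ?_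
    rw [hroot]
    exact mul_ne_zero hκ0 (sub_ne_zero.2 ((lt_min hlt hs).trans_le hz.1).ne')
  refine ⟨κ, S₁, hκ0, hnonneg.lt_of_ne fun h0 => ?_, hlt, hall⟩
  have h1 := hf.time_deriv_eq_of_stationary τ hτ
    (fun s hs => hf.hasDerivAt_gamma_of_isStationaryAt hs hτ (hall s (h0 ▸ hs)).1) S hS
  exact hi (h1.symm.trans hst.1)

theorem exists_kink (hf : IsPayoffFamily β r T Q M h q I G) {S τ₀ : ℝ} (hS : 0 < S)
    (hτ₀ : τ₀ ∈ Ioo 0 T) (hst : IsStationaryAt q I S τ₀) :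
    ∃ κ S₁, κ ≠ 0 ∧ 0 < S₁ ∧ ∀ τ ∈ Ioo 0 T, (∀ s, S₁ < s → q s τ = 0) ∧
      (∀ s ∈ Ioc 0 S₁, q s τ = I s τ) ∧ I S₁ τ = 0 ∧ HasDerivAt (fun s => I s τ) κ S₁ := by
  obtain ⟨κ, S₁, hκ, hS₁, -, hall⟩ := hf.exists_flux_eq_mul_sub hS hτ₀ hst
  refine ⟨κ, S₁, hκ, hS₁, fun τ hτ => ?_⟩
  have hall' : ∀ s, S₁ < s → IsStationaryAt q I s τ ∧ I s τ = κ * (s - S₁) := fun s hs => by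
    obtain ⟨h1, h2⟩ := hf.isStationaryAt_of_isStationaryAt (hS₁.trans hs) hτ₀ (hall s hs).1 τ hτ
    exact ⟨h1, h2.trans (hall s hs).2⟩
  have hd := hf.hasDerivAt_flux S₁ hS₁ τ hτ
  have hI0 : I S₁ τ = 0 := by
    have h1 : Tendsto (fun s => κ * (s - S₁)) (𝓝[>] S₁) (𝓝 0) :=
      (Continuous.tendsto' (by fun_prop) S₁ _ (by ring)).mono_left nhdsWithin_le_nhds
    refine tendsto_nhds_unique (hd.continuousAt.tendsto.mono_left nhdsWithin_le_nhds)
      (h1.congr' ?_)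
    filter_upwards [self_mem_nhdsWithin] with s hs using (hall' s hs).2.symm
  refine ⟨fun s hs => (hall' s hs).1.1, fun s hs => ?_, hI0, ?_⟩
  · by_contra hne
    have h0 := (hf.time_deriv_eq s hs.1 τ hτ).resolve_right hne
    have hst' := (hf.isStationaryAt_of_isStationaryAt hs.1 hτ ⟨h0, fun h1 => hne (h0.trans h1.symm)⟩
      τ₀ hτ₀).1
    obtain ⟨κ', S₂, hκ', -, hS₂, hall₂⟩ := hf.exists_flux_eq_mul_sub hs.1 hτ₀ hst'
    have hS₂₁ : S₂ < S₁ := hS₂.trans_le hs.2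
    have e1 := (hall (S₁ + 1) (by linarith)).2.symm.trans (hall₂ (S₁ + 1) (by linarith)).2
    have e2 := (hall (S₁ + 2) (by linarith)).2.symm.trans (hall₂ (S₁ + 2) (by linarith)).2
    have e3 : κ = κ' := by linarith
    rw [← e3] at e1
    have e4 := mul_left_cancel₀ hκ e1
    linarith
  · have h1 : HasDerivWithinAt (fun s => I s τ) κ (Ici S₁) S₁ := by
      have h2 : HasDerivWithinAt (fun s => κ * (s - S₁)) κ (Ici S₁) S₁ := by
        simpa using (((hasDerivAt_id S₁).sub_const S₁).const_mul κ).hasDerivWithinAt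
      refine h2.congr (fun s hs => ?_) (by rw [hI0]; ring)
      rcases (mem_Ici.1 hs).eq_or_lt with rfl | hlt
      · rw [hI0]; ring
      · exact (hall' s hlt).2
    have h3 := (uniqueDiffWithinAt_Ici S₁).eq_deriv _ hd.hasDerivWithinAt h1
    exact h3 ▸ hd

theorem not_isStationaryAt (hf : IsPayoffFamily β r T Q M h q I G) {S τ₀ : ℝ} (hS : 0 < S)
    (hτ₀ : τ₀ ∈ Ioo 0 T) : ¬IsStationaryAt q I S τ₀ := by
  intro hst
  obtain ⟨κ, S₁, hκ, hS₁, hk⟩ := hf.exists_kink hS hτ₀ hst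
  have hκ' : 0 < |κ| := abs_pos.2 hκ
  set A : ℕ → Set ℝ := fun n => {τ | ∀ s ∈ Ioc 0 S₁, S₁ - 1 / ((n : ℝ) + 1) ≤ s →
    |I s τ - κ * (s - S₁)| ≤ |κ| / 2 * (S₁ - s)} with hA
  have hclosed : ∀ n, IsClosed {τ : Ioo 0 T | (τ : ℝ) ∈ A n} := by
    intro n
    have h1 : {τ : Ioo 0 T | (τ : ℝ) ∈ A n} = ⋂ s ∈ Ioc 0 S₁,
        ⋂ (_ : S₁ - 1 / ((n : ℝ) + 1) ≤ s),
          {τ : Ioo 0 T | |I s τ - κ * (s - S₁)| ≤ |κ| / 2 * (S₁ - s)} := by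
      ext τ; simp [hA]
    rw [h1]
    refine isClosed_biInter fun s hs => isClosed_iInter fun _ => isClosed_le ?_ continuous_const
    have hc : Continuous fun τ : Ioo 0 T => I s τ := by
      refine continuous_iff_continuousAt.2 fun τ => ?_
      exact ContinuousAt.comp (g := fun p : ℝ × ℝ => I p.1 p.2) (f := fun u : Ioo 0 T => (s, (u : ℝ)))
        (hf.continuousAt_flux hs.1 τ.2) (by fun_prop)
    exact (hc.sub continuous_const).abs
  obtain ⟨n, J, hJ, hJne, hJA⟩ := IsGδ.exists_portion_subset (B := Ioo 0 T) isOpen_Ioo.isGδ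
    ⟨τ₀, hτ₀⟩ hclosed fun τ hτ => by
      have h1 := (hk τ hτ).2.2.2.isLittleO.def (half_pos hκ')
      rw [(hk τ hτ).2.2.1] at h1
      obtain ⟨ρ, hρ, hρb⟩ := Metric.nhds_basis_ball.eventually_iff.1 h1
      obtain ⟨n, hn⟩ := exists_nat_one_div_lt hρ
      refine ⟨n, fun s hs hns => ?_⟩
      have h2 := hρb (x := s) (by
        rw [Real.ball_eq_Ioo]; exact ⟨by linarith, by linarith [hs.2]⟩)
      simp only [sub_zero, smul_eq_mul, Real.norm_eq_abs] at h2
      rw [abs_sub_comm s S₁, abs_of_nonneg (sub_nonneg.2 hs.2), mul_comm _ κ] at h2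
      exact h2
  obtain ⟨τ₁, hτ₁⟩ := hJne
  obtain ⟨ε, hε, hεb⟩ := Metric.nhds_basis_closedBall.mem_iff.1
    ((hJ.inter isOpen_Ioo).mem_nhds hτ₁)
  have hsub : Icc τ₁ (τ₁ + ε) ⊆ J ∩ Ioo 0 T := fun t ht => hεb (by
    rw [Real.closedBall_eq_Icc]; exact ⟨by linarith [ht.1], ht.2⟩)
  have hlt : τ₁ < τ₁ + ε := by linarith
  have hmvt : ∀ s, 0 < s → ∃ ξ ∈ Icc τ₁ (τ₁ + ε), Q s (τ₁ + ε) - Q s τ₁ = q s ξ * ε := by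
    intro s hs
    obtain ⟨ξ, hξ, hξe⟩ := exists_hasDerivAt_eq_slope (fun t => Q s t) (fun t => q s t) hlt
      (fun t ht => (hf.hasDerivAt_time s hs t (hsub ht).2).continuousAt.continuousWithinAt)
      (fun t ht => hf.hasDerivAt_time s hs t (hsub (Ioo_subset_Icc_self ht)).2)
    refine ⟨ξ, Ioo_subset_Icc_self hξ, ?_⟩
    rw [hξe, add_sub_cancel_left, div_mul_cancel₀ _ hε.ne']
  have hE : HasDerivAt (fun s => Q s (τ₁ + ε) - Q s τ₁) (M S₁ (τ₁ + ε) - M S₁ τ₁) S₁ :=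
    (hf.hasDerivAt_value S₁ hS₁ _ (hsub ⟨hlt.le, le_rfl⟩).2).sub
      (hf.hasDerivAt_value S₁ hS₁ _ (hsub ⟨le_rfl, hlt.le⟩).2)
  have hE0 : ∀ s ∈ Ici S₁, Q s (τ₁ + ε) - Q s τ₁ = 0 := by
    intro s hs
    obtain ⟨ξ, hξ, hξe⟩ := hmvt s (hS₁.trans_le hs)
    rw [hξe]
    rcases (mem_Ici.1 hs).eq_or_lt with rfl | h1
    · rw [(hk ξ (hsub hξ).2).2.1 S₁ ⟨hS₁, le_rfl⟩, (hk ξ (hsub hξ).2).2.2.1, zero_mul]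
    · rw [(hk ξ (hsub hξ).2).1 s h1, zero_mul]
  have hd0 : M S₁ (τ₁ + ε) - M S₁ τ₁ = 0 :=
    (uniqueDiffWithinAt_Ici S₁).eq_deriv _ hE.hasDerivWithinAt
      ((hasDerivWithinAt_const S₁ (Ici S₁) (0 : ℝ)).congr hE0 (hE0 S₁ self_mem_Ici))
  rw [hd0] at hE
  have hlow : ∀ s ∈ Ioo 0 S₁, S₁ - 1 / ((n : ℝ) + 1) ≤ s →
      |κ| / 2 * ε * (S₁ - s) ≤ |Q s (τ₁ + ε) - Q s τ₁| := by
    intro s hs hns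
    obtain ⟨ξ, hξ, hξe⟩ := hmvt s hs.1
    rw [hξe, (hk ξ (hsub hξ).2).2.1 s (Ioo_subset_Ioc_self hs), abs_mul, abs_of_pos hε]
    have h1 := hJA (hsub hξ) s (Ioo_subset_Ioc_self hs) hns
    have h2 := abs_sub_abs_le_abs_sub (κ * (s - S₁)) (I s ξ)
    rw [abs_sub_comm _ (I s ξ), abs_mul, abs_sub_comm s S₁, abs_of_pos (sub_pos.2 hs.2)] at h2
    have h3 : |κ| / 2 * (S₁ - s) ≤ |I s ξ| := by linarith
    calc |κ| / 2 * ε * (S₁ - s) = |κ| / 2 * (S₁ - s) * ε := by ring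
      _ ≤ |I s ξ| * ε := by gcongr
  have hlittle := hE.isLittleO.def (show 0 < |κ| / 2 * ε / 2 by positivity)
  rw [hE0 S₁ self_mem_Ici] at hlittle
  have hev : ∀ᶠ s in 𝓝[<] S₁, s ∈ Ioo 0 S₁ ∧ S₁ - 1 / ((n : ℝ) + 1) ≤ s := by
    have h1 : S₁ - 1 / ((n : ℝ) + 1) < S₁ := sub_lt_self _ Nat.one_div_pos_of_nat
    filter_upwards [Ioo_mem_nhdsLT hS₁, Ioo_mem_nhdsLT h1] with s h2 h3 using ⟨h2, h3.1.le⟩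
  obtain ⟨s, ⟨hs, hns⟩, h1⟩ := (hev.and (nhdsWithin_le_nhds hlittle)).exists
  have h2 := hlow s hs hns
  simp only [sub_zero, smul_zero, Real.norm_eq_abs] at h1
  rw [abs_sub_comm s S₁, abs_of_pos (sub_pos.2 hs.2)] at h1
  have h3 : 0 < |κ| / 2 * ε * (S₁ - s) := mul_pos (by positivity) (sub_pos.2 hs.2)
  linarith

theorem time_deriv_eq_flux (hf : IsPayoffFamily β r T Q M h q I G) {S τ : ℝ} (hS : 0 < S)
    (hτ : τ ∈ Ioo 0 T) : q S τ = I S τ := by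
  by_contra hne
  have h0 := (hf.time_deriv_eq S hS τ hτ).resolve_right hne
  exact hf.not_isStationaryAt hS hτ ⟨h0, fun h1 => hne (h0.trans h1.symm)⟩

end IsPayoffFamily

open Set Topology in
theorem tendsto_setIntegral_Iio_atBot {f : ℝ → ℝ} {a : ℝ} (hf : IntegrableOn f (Iio a)) :
    Tendsto (fun b => ∫ x in Iio b, f x) atBot (𝓝 0) := by
  have hf' : IntegrableOn f (Iic a) := (integrableOn_Iic_iff_integrableOn_Iio).2 hf
  have h1 := (intervalIntegral_tendsto_integral_Iic a hf' tendsto_id).const_sub (∫ x in Iic a, f x)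
  rw [sub_self] at h1
  refine h1.congr' ?_
  filter_upwards [eventually_le_atBot a] with b hb
  rw [← integral_Iic_eq_integral_Iio, id, ← intervalIntegral.integral_Iic_sub_Iic
    (hf'.mono_set (Iic_subset_Iic.2 hb)) hf', sub_sub_cancel]

open Set Topology in
theorem hasDerivAt_setIntegral_Iio {f : ℝ → ℝ} {a : ℝ} (hf : Continuous f)
    (hint : IntegrableOn f (Iio a)) : HasDerivAt (fun b => ∫ x in Iio b, f x) (f a) a := by
  have hint' : ∀ b, IntegrableOn f (Iic b) := fun b => by
    have h1 : IntegrableOn f (Icc a b) := hf.continuousOn.integrableOn_Icc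
    refine (hint.union h1).mono_set fun x hx => ?_
    rcases lt_or_ge x a with h | h
    · exact Or.inl h
    · exact Or.inr ⟨h, hx⟩
  have h1 := (intervalIntegral.integral_hasDerivAt_right (hf.intervalIntegrable a a)
    (hf.stronglyMeasurableAtFilter _ _) hf.continuousAt).const_add (∫ x in Iic a, f x)
  refine h1.congr_of_eventuallyEq (Eventually.of_forall fun b => ?_)
  change ∫ x in Iio b, f x = (∫ x in Iic a, f x) + ∫ x in a..b, f x
  rw [← integral_Iic_eq_integral_Iio, ← intervalIntegral.integral_Iic_sub_Iic (hint' a) (hint' b),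
    add_sub_cancel]

theorem hasDerivAt_log_div {E S : ℝ} (hE : 0 < E) (hS : 0 < S) :
    HasDerivAt (fun s => Real.log (s / E)) (1 / S) S := by
  have h1 := ((hasDerivAt_id S).div_const E).log (by simp only [id]; positivity)
  refine h1.congr_deriv ?_
  simp only [id]
  field_simp

namespace IsGammaSolution

open Set Topology

variable {β : ℝ → ℝ} {r T : ℝ} {H : ℝ → ℝ → ℝ}

theorem flux_add_eq_of_deriv_time_eq_zero (hs : IsGammaSolution β r T H) {τ : ℝ}
    (hτ : τ ∈ Ioo 0 T) {a b : ℝ} (hab : a ≤ b)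
    (h : ∀ x ∈ Icc a b, deriv (fun t => H x t) τ = 0) :
    β (H b τ) + deriv (fun y => β (H y τ)) b + r * H b τ
      = β (H a τ) + deriv (fun y => β (H y τ)) a + r * H a τ := by
  set w := deriv fun y => β (H y τ) with hw
  have hwc : Continuous w := hs.continuous_deriv_comp_space hτ
  have hHxc := hs.continuous_deriv_space hτ
  have hF : ∀ x ∈ Ioo a b, deriv w x = -w x - r * deriv (fun y => H y τ) x := fun x hx => by
    have h1 := h x (Ioo_subset_Icc_self hx)
    rw [hs.deriv_time_eq x τ hτ] at h1
    change deriv w x + w x + _ = 0 at h1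
    linarith
  have i1 : IntervalIntegrable (fun x => -w x) volume a b := hwc.neg.intervalIntegrable _ _
  have i2 : IntervalIntegrable (fun x => r * deriv (fun y => H y τ) x) volume a b :=
    (hHxc.const_mul r).intervalIntegrable _ _
  have hftc := integral_eq_sub_of_hasDerivAt_of_ne_zero (f := w)
    (f' := fun x => -w x - r * deriv (fun y => H y τ) x)
    (s := {x | w x = 0 ∧ deriv w x ≠ 0}) hab hwc.continuousOn
    (fun x hx hx0 => by
      rw [← hF x hx]
      refine (hs.differentiableAt_flux hτ fun h0 => hx0 ?_).hasDerivAt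
      rw [hw, hs.deriv_comp_space hτ]
      simp only [h0, zero_mul])
    (countable_setOf_eq_zero_and_deriv_ne_zero w)
    (fun x hx hxs h0 => by
      rw [← hF x hx]
      by_contra h1
      exact hxs ⟨h0, h1⟩)
    (i1.sub i2)
  rw [intervalIntegral.integral_sub i1 i2, intervalIntegral.integral_neg,
    intervalIntegral.integral_const_mul,
    intervalIntegral.integral_eq_sub_of_hasDerivAt
      (fun x _ => (hs.hasDerivAt_comp_space hτ x).differentiableAt.hasDerivAt)
      (hwc.intervalIntegrable _ _),
    intervalIntegral.integral_eq_sub_of_hasDerivAt (fun x _ => hs.hasDerivAt_space hτ x)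
      (hHxc.intervalIntegrable _ _)] at hftc
  linarith

theorem isPayoffFamily (hs : IsGammaSolution β r T H) (hβ0 : β 0 = 0) {E : ℝ} (hE : 0 < E)
    (hlim0 : ∀ τ ∈ Ioo 0 T, Tendsto (fun x => H x τ) atBot (𝓝 0))
    (hlim1 : ∀ τ ∈ Ioo 0 T, Tendsto (deriv fun y => H y τ) atBot (𝓝 0))
    (hint : ∀ S ∈ Ioi (0 : ℝ), ∀ τ ∈ Ioo 0 T,
      IntegrableOn (fun x => H x τ) (Iio (Real.log (S / E))))
    (hexp : ∀ S ∈ Ioi (0 : ℝ), ∀ τ ∈ Ioo 0 T,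
      IntegrableOn (fun x => Real.exp x * H x τ) (Iio (Real.log (S / E))))
    (htime : ∀ S ∈ Ioi (0 : ℝ), ∀ τ ∈ Ioo 0 T,
      HasDerivAt (fun t => ∫ x, max (S - E * Real.exp x) 0 * H x t)
        (∫ x, max (S - E * Real.exp x) 0 * deriv (fun t => H x t) τ) τ)
    (hvalue : ∀ S ∈ Ioi (0 : ℝ), ∀ τ ∈ Ioo 0 T,
      HasDerivAt (fun s => ∫ x, max (s - E * Real.exp x) 0 * H x τ)
        (∫ x in Iio (Real.log (S / E)), H x τ) S) :
    IsPayoffFamily β r T (fun S τ => ∫ x, max (S - E * Real.exp x) 0 * H x τ)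
      (fun S τ => ∫ x in Iio (Real.log (S / E)), H x τ) (fun S τ => H (Real.log (S / E)) τ)
      (fun S τ => ∫ x, max (S - E * Real.exp x) 0 * deriv (fun t => H x t) τ)
      (payoffFlux β r E H)
      (fun S τ => β (H (Real.log (S / E)) τ) + deriv (fun y => β (H y τ)) (Real.log (S / E))
        + r * H (Real.log (S / E)) τ) := by
  have hlog : ∀ S ∈ Ioi (0 : ℝ), ContinuousAt (fun s => Real.log (s / E)) S := fun S hS =>
    (hasDerivAt_log_div hE hS).continuousAt
  have hdelta : ∀ S ∈ Ioi (0 : ℝ), ∀ τ ∈ Ioo 0 T,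
      HasDerivAt (fun s => ∫ x in Iio (Real.log (s / E)), H x τ)
        (H (Real.log (S / E)) τ / S) S := fun S hS τ hτ => by
    refine ((hasDerivAt_setIntegral_Iio (hs.continuous_space hτ) (hint S hS τ hτ)).comp S
      (hasDerivAt_log_div hE hS)).congr_deriv ?_
    ring
  have hflux : ∀ S ∈ Ioi (0 : ℝ), ∀ τ ∈ Ioo 0 T, payoffFlux β r E H S τ
      = S * β (H (Real.log (S / E)) τ) + r * (S * (∫ x in Iio (Real.log (S / E)), H x τ)
        - ∫ x, max (S - E * Real.exp x) 0 * H x τ) := fun S hS τ hτ => by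
    have h1 : ∀ x, (S - E * Real.exp x) * H x τ = S * H x τ - E * (Real.exp x * H x τ) :=
      fun x => by ring
    rw [payoffFlux, max_payoff_mul_eq_indicator hE hS, integral_indicator measurableSet_Iio]
    simp_rw [h1]
    rw [integral_sub ((hint S hS τ hτ).const_mul S) ((hexp S hS τ hτ).const_mul E),
      integral_const_mul, integral_const_mul, sub_sub_cancel]
  refine ⟨hs.contDiff_nonlinearity.continuous, fun S hS τ hτ => ?_, htime, hvalue, hdelta, hflux,
    fun S hS τ hτ => ?_, fun S hS τ hτ => ?_, fun τ hτ => ?_, fun S hS τ hτ => ?_,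
    fun S hS τ hτ h => ?_, fun τ hτ h S hS => ?_⟩
  · refine ContinuousAt.comp (g := fun p : ℝ × ℝ => H p.1 p.2)
      (f := fun p : ℝ × ℝ => (Real.log (p.1 / E), p.2))
      (hs.continuousOn.continuousAt (prod_mem_nhds univ_mem (Ioo_mem_nhds hτ.1 hτ.2))) ?_
    exact ((hlog S hS).comp (f := fun p : ℝ × ℝ => p.1) (x := (S, τ)) continuousAt_fst).prodMk
      continuousAt_snd
  · have hd := (hasDerivAt_id S).mul ((hs.hasDerivAt_comp_space hτ (Real.log (S / E))).comp S
      (hasDerivAt_log_div hE hS))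
    have hd' := hd.add ((((hasDerivAt_id S).mul (hdelta S hS τ hτ)).sub
      (hvalue S hS τ hτ)).const_mul r)
    have hS' : S ≠ 0 := ne_of_gt hS
    refine (hd'.congr_of_eventuallyEq ?_).congr_deriv ?_
    · filter_upwards [Ioi_mem_nhds hS] with s hs' using hflux s hs' τ hτ
    · simp only [hs.deriv_comp_space hτ, Function.comp_apply, id]
      field_simp
      ring
  · have h1 : Continuous fun x => β (H x τ) + deriv (fun y => β (H y τ)) x + r * H x τ :=
      ((hs.contDiff_nonlinearity.continuous.comp (hs.continuous_space hτ)).add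
        (hs.continuous_deriv_comp_space hτ)).add ((hs.continuous_space hτ).const_mul r)
    exact h1.continuousAt.comp (hlog S hS)
  · have hL : Tendsto (fun s => Real.log (s / E)) (𝓝[>] 0) atBot := by
      refine Real.tendsto_log_nhdsGT_zero.comp ?_
      refine tendsto_nhdsWithin_iff.2 ⟨?_, ?_⟩
      · exact (Continuous.tendsto' (by fun_prop) 0 0 (by simp)).mono_left nhdsWithin_le_nhds
      · filter_upwards [self_mem_nhdsWithin] with s hs' using div_pos hs' hE
    have h1 : Tendsto (fun s => β (H (Real.log (s / E)) τ)) (𝓝[>] 0) (𝓝 0) := by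
      have := (hs.contDiff_nonlinearity.continuous.tendsto 0).comp ((hlim0 τ hτ).comp hL)
      rwa [hβ0] at this
    have h2 := (tendsto_setIntegral_Iio_atBot (hexp 1 (Set.mem_Ioi.2 one_pos) τ hτ)).comp hL
    have h3 : Tendsto (fun s : ℝ => s) (𝓝[>] 0) (𝓝 0) := nhdsWithin_le_nhds
    simpa [payoffFlux] using (h3.mul h1).add ((h2.const_mul E).const_mul r)
  · by_cases hi : Integrable fun x => max (S - E * Real.exp x) 0 * deriv (fun t => H x t) τ
    · exact Or.inr (hs.integral_payoff_mul_deriv_time hβ0 hτ hE hS (hlim0 τ hτ) (hlim1 τ hτ)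
        (hexp S hS τ hτ) hi)
    · exact Or.inl (integral_undef hi)
  · obtain ⟨ρ, hρ, hρb⟩ := Metric.nhds_basis_ball.eventually_iff.1
      (h.and (Ioi_mem_nhds hS))
    have hx : ∀ s ∈ Metric.ball S ρ, ∀ s' ∈ Metric.ball S ρ,
        ∀ x ∈ Icc (Real.log (s / E)) (Real.log (s' / E)), deriv (fun t => H x t) τ = 0 := by
      intro s hs' s' hs'' x hx
      have hp := div_pos (hρb hs').2 hE
      have hp' := div_pos (hρb hs'').2 hE
      have h1 := (Real.log_le_iff_le_exp hp).1 hx.1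
      have h2 := (Real.le_log_iff_exp_le hp').1 hx.2
      rw [div_le_iff₀ hE] at h1
      rw [le_div_iff₀ hE] at h2
      have h3 := (hρb ((convex_ball S ρ).ordConnected.out hs' hs'' ⟨h1, h2⟩)).1
      rw [mul_div_cancel_right₀ _ hE.ne', Real.log_exp] at h3
      exact h3.deriv
    filter_upwards [Metric.ball_mem_nhds S hρ] with s hs'
    rcases le_total (Real.log (S / E)) (Real.log (s / E)) with hle | hle
    · exact hs.flux_add_eq_of_deriv_time_eq_zero hτ hle (hx S (Metric.mem_ball_self hρ) s hs')
    · exact (hs.flux_add_eq_of_deriv_time_eq_zero hτ hle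
        (hx s hs' S (Metric.mem_ball_self hρ))).symm
  · have hx : ∀ x, deriv (fun t => H x t) τ = 0 := fun x => by
      have h1 := h (E * Real.exp x) (by exact mul_pos hE (Real.exp_pos x))
      rw [mul_div_cancel_left₀ _ hE.ne', Real.log_exp] at h1
      exact h1.deriv
    refine hs.integral_payoff_mul_deriv_time hβ0 hτ hE hS (hlim0 τ hτ) (hlim1 τ hτ)
      (hexp S hS τ hτ) ?_
    simp [hx]

end IsGammaSolution

/-- If `H` is a sufficiently smooth solution of the Gamma equation
`∂_τ H = ∂²_x β(H) + ∂_x β(H) + r ∂_x H` on `ℝ × (0,T)`, with `H(x,τ) → 0` and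
`∂_x H(x,τ) → 0` as `x → −∞`, and suitable integrability (with differentiation under
the integral sign justified), then
`V(S,t) = aS + b e^{−r(T−t)} + ∫_{−∞}^∞ (S − Ee^x)⁺ H(x,T−t) dx` satisfies
`S ∂²_S V = H(ln(S/E), T−t)` and solves the nonlinear Black–Scholes equation
`∂_t V + S β(S ∂²_S V) + r S ∂_S V − r V = 0` on `(0,∞) × (0,T)`. -/
theorem blackScholes_of_gamma_solution
    (r T E a b : ℝ) (hT : 0 < T) (hE : 0 < E)
    (β : ℝ → ℝ) (hβ : ContDiff ℝ 1 β) (hβ0 : β 0 = 0)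
    (H : ℝ → ℝ → ℝ)
    -- smoothness of H
    (hHcont : ContinuousOn (fun p : ℝ × ℝ => H p.1 p.2) (Set.univ ×ˢ Set.Ioo 0 T))
    (hHx : ∀ τ ∈ Set.Ioo (0:ℝ) T, ContDiff ℝ 2 fun x => H x τ)
    (hHτ : ∀ x : ℝ, ContDiffOn ℝ 1 (fun τ => H x τ) (Set.Ioo 0 T))
    -- H solves the Gamma equation
    (hGamma : ∀ x : ℝ, ∀ τ ∈ Set.Ioo (0:ℝ) T,
      deriv (fun τ' => H x τ') τ
        = deriv (deriv (fun x' => β (H x' τ))) x + deriv (fun x' => β (H x' τ)) x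
          + r * deriv (fun x' => H x' τ) x)
    -- boundary behaviour as x → −∞
    (hlim0 : ∀ τ ∈ Set.Ioo (0:ℝ) T, Tendsto (fun x => H x τ) atBot (nhds 0))
    (hlim1 : ∀ τ ∈ Set.Ioo (0:ℝ) T,
      Tendsto (fun x => deriv (fun x' => H x' τ) x) atBot (nhds 0))
    -- integrability
    (hint1 : ∀ S ∈ Set.Ioi (0:ℝ), ∀ τ ∈ Set.Ioo (0:ℝ) T,
      IntegrableOn (fun x => (S - E * Real.exp x) * H x τ) (Set.Iio (Real.log (S / E))))
    (hint2 : ∀ S ∈ Set.Ioi (0:ℝ), ∀ τ ∈ Set.Ioo (0:ℝ) T,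
      IntegrableOn (fun x => Real.exp x * H x τ) (Set.Iio (Real.log (S / E))))
    -- definition of V
    (V : ℝ → ℝ → ℝ)
    (hV : ∀ S t, V S t = a * S + b * Real.exp (-(r * (T - t)))
      + ∫ x : ℝ, max (S - E * Real.exp x) 0 * H x (T - t))
    -- differentiation under the integral sign is justified
    (hdifft : ∀ S ∈ Set.Ioi (0:ℝ), ∀ t ∈ Set.Ioo (0:ℝ) T,
      HasDerivAt (fun t' => ∫ x : ℝ, max (S - E * Real.exp x) 0 * H x (T - t'))
        (∫ x : ℝ, max (S - E * Real.exp x) 0 * (-(deriv (fun τ => H x τ) (T - t)))) t)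
    (hdiffS : ∀ S ∈ Set.Ioi (0:ℝ), ∀ t ∈ Set.Ioo (0:ℝ) T,
      HasDerivAt (fun S' => ∫ x : ℝ, max (S' - E * Real.exp x) 0 * H x (T - t))
        (∫ x in Set.Iio (Real.log (S / E)), H x (T - t)) S) :
    ∀ S ∈ Set.Ioi (0:ℝ), ∀ t ∈ Set.Ioo (0:ℝ) T,
      S * deriv (deriv (fun S' => V S' t)) S = H (Real.log (S / E)) (T - t) ∧
      deriv (fun t' => V S t') t + S * β (S * deriv (deriv (fun S' => V S' t)) S)
        + r * S * deriv (fun S' => V S' t) S - r * V S t = 0 := by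
  have hmem : ∀ t ∈ Set.Ioo (0 : ℝ) T, T - t ∈ Set.Ioo (0 : ℝ) T := fun t ht =>
    ⟨sub_pos.2 ht.2, sub_lt_self T ht.1⟩
  have hs : IsGammaSolution β r T H := ⟨hβ, hHcont, hHx, fun x τ hτ =>
    ((hHτ x).differentiableOn one_ne_zero).differentiableAt (Ioo_mem_nhds hτ.1 hτ.2), hGamma⟩
  have hint : ∀ S ∈ Set.Ioi (0 : ℝ), ∀ τ ∈ Set.Ioo 0 T,
      IntegrableOn (fun x => H x τ) (Set.Iio (Real.log (S / E))) := fun S hS τ hτ => by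
    have hS' : S ≠ 0 := ne_of_gt hS
    refine (((hint1 S hS τ hτ).add ((hint2 S hS τ hτ).const_mul E)).const_mul S⁻¹).congr
      (Eventually.of_forall fun x => ?_)
    simp only [Pi.add_apply]
    field_simp
    ring
  have htime : ∀ S ∈ Set.Ioi (0 : ℝ), ∀ τ ∈ Set.Ioo 0 T,
      HasDerivAt (fun t => ∫ x, max (S - E * Real.exp x) 0 * H x t)
        (∫ x, max (S - E * Real.exp x) 0 * deriv (fun t => H x t) τ) τ := fun S hS τ hτ => by
    have h1 := hdifft S hS (T - τ) (hmem τ hτ)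
    have h2 := h1.comp τ ((hasDerivAt_id τ).const_sub T)
    simp only [Function.comp_def, sub_sub_cancel, mul_neg, integral_neg, mul_one,
      neg_neg] at h2
    exact h2
  have hvalue : ∀ S ∈ Set.Ioi (0 : ℝ), ∀ τ ∈ Set.Ioo 0 T,
      HasDerivAt (fun s => ∫ x, max (s - E * Real.exp x) 0 * H x τ)
        (∫ x in Set.Iio (Real.log (S / E)), H x τ) S := fun S hS τ hτ => by
    have h1 := hdiffS S hS (T - τ) (hmem τ hτ)
    rwa [sub_sub_cancel] at h1
  have hf := hs.isPayoffFamily hβ0 hE hlim0 hlim1 hint hint2 htime hvalue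
  intro S hS t ht
  have hτ := hmem t ht
  have hS' : S ≠ 0 := ne_of_gt hS
  have hVS : ∀ s ∈ Set.Ioi (0 : ℝ), deriv (fun S' => V S' t) s
      = a + ∫ x in Set.Iio (Real.log (s / E)), H x (T - t) := fun s hs' => by
    simp only [hV]
    exact (((((hasDerivAt_id s).const_mul a).add_const _).add
      (hvalue s hs' _ hτ)).congr_deriv (by rw [mul_one])).deriv
  have hVSS : S * deriv (deriv fun S' => V S' t) S = H (Real.log (S / E)) (T - t) := by
    have h1 : deriv (fun S' => V S' t) =ᶠ[nhds S] fun s =>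
        a + ∫ x in Set.Iio (Real.log (s / E)), H x (T - t) := by
      filter_upwards [Ioi_mem_nhds hS] using hVS
    rw [h1.deriv_eq, ((hf.hasDerivAt_delta S hS _ hτ).const_add a).deriv, mul_div_cancel₀ _ hS']
  have hVt : deriv (fun t' => V S t') t = r * b * Real.exp (-(r * (T - t)))
      - ∫ x, max (S - E * Real.exp x) 0 * deriv (fun τ => H x τ) (T - t) := by
    have h1 : HasDerivAt (fun t' => b * Real.exp (-(r * (T - t'))))
        (b * (Real.exp (-(r * (T - t))) * -(r * -1))) t :=
      ((((hasDerivAt_id t).const_sub T).const_mul r).neg.exp).const_mul b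
    simp only [hV]
    refine (((h1.const_add (a * S)).add (hdifft S hS t ht)).congr_deriv ?_).deriv
    simp only [mul_neg, integral_neg]
    ring
  refine ⟨hVSS, ?_⟩
  have h1 := hf.time_deriv_eq_flux hS hτ
  have h2 := hf.flux_eq S hS _ hτ
  rw [hVSS, hVt, hVS S hS, hV]
  rw [h1, h2]
  ring
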